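/- (Prime ends compactification theorem, plane case, U not necessarily bounded.) Let U ⊆ ℝ² be an open simply connected set such that ℝ²∖U has more than one point (U may be unbounded). Then the space of prime ends b_E(U,ℝ²) is homeomorphic to the circle S¹, and the prime ends compactification c_E(U,ℝ²) is homeomorphic to the closed unit disk in ℝ². -/

import Mathlib

open Set Topology Filter

noncomputable section

universe u

variable {X : Type u} [TopologicalSpace X]

/-- A homeomorphism is *orientation preserving* if it is isotopic to the identity. -/
def IsOrientationPreserving (f : X ≃ₜ X) : Prop :=
  ∃ H : unitInterval × X → X,
    Continuous H ∧ (∀ x, H (0, x) = x) ∧ (∀ x, H (1, x) = f x) ∧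
      ∀ t : unitInterval, IsHomeomorph fun x => H (t, x)

/-- `D` is a connected component of `A`. -/
def IsCompOf (A D : Set X) : Prop := ∃ x ∈ A, D = connectedComponentIn A x

/-- `A` has exactly two connected components, the distinct sets `D₁` and `D₂`. -/
def HasTwoComps (A D₁ D₂ : Set X) : Prop :=
  IsCompOf A D₁ ∧ IsCompOf A D₂ ∧ D₁ ≠ D₂ ∧
    ∀ x ∈ A, connectedComponentIn A x = D₁ ∨ connectedComponentIn A x = D₂

/-- A *cross-cut* of the open set `U`: the image of an arc `g` on `(0,1)`, where `g` is
continuous and injective on `[0,1]`'s interior, runs inside `U`, has endpoints on `∂U`, and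
separates `U` into exactly two components, each with a boundary point on `∂U` away from the
closed arc. -/
def IsCrossCut (U γ : Set X) : Prop :=
  ∃ g : ℝ → X,
    ContinuousOn g (Icc 0 1) ∧ InjOn g (Ioo 0 1) ∧ (∀ t ∈ Ioo (0:ℝ) 1, g t ∈ U) ∧
      g 0 ∈ frontier U ∧ g 1 ∈ frontier U ∧ γ = g '' Ioo 0 1 ∧
      ∃ D₁ D₂ : Set X, HasTwoComps (U \ γ) D₁ D₂ ∧
        (frontier D₁ ∩ (frontier U \ g '' Icc 0 1)).Nonempty ∧
        (frontier D₂ ∩ (frontier U \ g '' Icc 0 1)).Nonempty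

/-- A *cross-section* of `U`: a connected component of `U ∖ γ` for a cross-cut `γ`. -/
def IsCrossSection (U D : Set X) : Prop := ∃ γ : Set X, IsCrossCut U γ ∧ IsCompOf (U \ γ) D

/-- The image of a set under the `k`-th integer iterate of a homeomorphism. -/
def iterZ (f : X ≃ₜ X) (k : ℤ) (A : Set X) : Set X := ⇑(f.toEquiv ^ k) '' A

/-- A cross-section of `U` which is wandering for `f^n`. -/
def IsWanderingSection (f : X ≃ₜ X) (U : Set X) (n : ℕ) (D : Set X) : Prop :=
  IsCrossSection U D ∧ ∀ k : ℤ, k ≠ 0 → iterZ f ((n : ℤ) * k) D ∩ D = ∅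

/-- `f` is ∂-nonwandering in `U`. -/
def BdNonwandering (f : X ≃ₜ X) (U : Set X) : Prop :=
  ∀ n : ℕ, 1 ≤ n → ∃ K : Set X, IsCompact K ∧ K ⊆ U ∧
    ∀ D : Set X, IsWanderingSection f U n D →
      (∃ k : ℤ, 0 < k ∧ (iterZ f ((n : ℤ) * k) D ∩ K).Nonempty) ∧
      (∃ k : ℤ, k < 0 ∧ (iterZ f ((n : ℤ) * k) D ∩ K).Nonempty)

/-- The boundary of `D` inside `U` (for `D` open in `U`). -/
def bdIn (U D : Set X) : Set X := (closure D \ D) ∩ U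

/-- A chain of cross-sections of `U`. -/
def IsPEChain (U : Set X) (D : ℕ → Set X) : Prop :=
  (∀ i, IsCrossSection U (D i)) ∧ (∀ i j : ℕ, j ≤ i → D i ⊆ D j) ∧
    ∀ i j : ℕ, i ≠ j → closure (bdIn U (D i)) ∩ closure (bdIn U (D j)) = ∅

/-- The chain `D` divides the cross-section `E`. -/
def ChainDividesSection (D : ℕ → Set X) (E : Set X) : Prop := ∃ N : ℕ, ∀ i, N ≤ i → D i ⊆ E

/-- The chain `D` divides the chain `D'`. -/
def ChainDivides (D D' : ℕ → Set X) : Prop := ∀ n : ℕ, ∃ m : ℕ, D m ⊆ D' n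

/-- A prime chain: a chain dividing every chain that divides it. -/
def IsPrimeChain (U : Set X) (D : ℕ → Set X) : Prop :=
  IsPEChain U D ∧ ∀ D' : ℕ → Set X, IsPEChain U D' → ChainDivides D' D → ChainDivides D D'

/-- The type of prime chains of `U`. -/
def PrimeChain (U : Set X) : Type u := {D : ℕ → Set X // IsPrimeChain U D}

/-- A prime end of `U`: an equivalence class of prime chains. -/
def PrimeEnd (U : Set X) : Type u :=
  Quot fun C C' : PrimeChain U => ChainDivides C.1 C'.1 ∧ ChainDivides C'.1 C.1

/-- The prime end `p` divides the cross-section `E`. -/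
def PrimeEndDivides {U : Set X} (p : PrimeEnd U) (E : Set X) : Prop :=
  ∃ C : PrimeChain U, Quot.mk _ C = p ∧ ChainDividesSection C.1 E

/-- The prime ends compactification of `U` (as a set: `U ⊔ (prime ends)`). -/
def PrimeEndComp (U : Set X) : Type u := ↥U ⊕ PrimeEnd U

/-- A point of `U`, as an element of the prime ends compactification. -/
def pePt (U : Set X) (x : ↥U) : PrimeEndComp U := Sum.inl x

/-- A prime end, as an element of the prime ends compactification. -/
def peEnd (U : Set X) (p : PrimeEnd U) : PrimeEndComp U := Sum.inr p

/-- The copy of a subset `V ⊆ U` inside the prime ends compactification. -/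
def peOpen (U V : Set X) : Set (PrimeEndComp U) := {z | ∃ x : ↥U, z = pePt U x ∧ (x : X) ∈ V}

/-- The basic set `E ∪ i_E(E)` of the prime ends compactification, for a cross-section `E`. -/
def peSection (U E : Set X) : Set (PrimeEndComp U) :=
  peOpen U E ∪ {z | ∃ p : PrimeEnd U, z = peEnd U p ∧ PrimeEndDivides p E}

/-- The topology of the prime ends compactification. -/
instance primeEndCompTopology (U : Set X) : TopologicalSpace (PrimeEndComp U) :=
  TopologicalSpace.generateFrom
    ({s | ∃ V : Set X, IsOpen V ∧ V ⊆ U ∧ s = peOpen U V} ∪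
      {s | ∃ E : Set X, IsCrossSection U E ∧ s = peSection U E})

/-- The circle of prime ends, as a subset of the prime ends compactification. -/
def PrimeEndCircle (U : Set X) : Set (PrimeEndComp U) := Set.range (peEnd U)

/-- `F` is an extension of `f|_U` to the prime ends compactification of `U`. -/
def IsPEExtension (f : X ≃ₜ X) (U : Set X) (F : PrimeEndComp U ≃ₜ PrimeEndComp U) : Prop :=
  ∀ (x : X) (hx : x ∈ U) (hfx : f x ∈ U), F (pePt U ⟨x, hx⟩) = pePt U ⟨f x, hfx⟩

/-- An end-cut of `U`: an injective arc in `U` defined on `[0,1)` converging in the ambient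
space as `t → 1⁻`. -/
def IsEndCut (U : Set X) (γ : ℝ → X) : Prop :=
  ContinuousOn γ (Ico 0 1) ∧ InjOn γ (Ico 0 1) ∧ (∀ t ∈ Ico (0:ℝ) 1, γ t ∈ U) ∧
    ∃ z : X, Tendsto γ (𝓝[<] (1:ℝ)) (𝓝 z)

/-- `z` is an accessible point of `∂U`. -/
def IsAccessiblePoint (U : Set X) (z : X) : Prop :=
  ∃ γ : ℝ → X, IsEndCut U γ ∧ Tendsto γ (𝓝[<] (1:ℝ)) (𝓝 z)

/-- `p` is an accessible prime end of `U`. -/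
def IsAccessiblePrimeEnd (U : Set X) (p : PrimeEnd U) : Prop :=
  ∃ (γ : ℝ → X) (hγ : ∀ t ∈ Ico (0:ℝ) 1, γ t ∈ U), IsEndCut U γ ∧
    Tendsto (fun t : ↥(Ico (0:ℝ) 1) => pePt U ⟨γ ↑t, hγ ↑t t.2⟩)
      (comap Subtype.val (𝓝[<] (1:ℝ))) (𝓝 (peEnd U p))

/-- A translation arc for `f` based at `x`: a simple arc from `x` to `f x` meeting its image
only as allowed. -/
def IsTranslationArc (f : X ≃ₜ X) (γ : Set X) (x : X) : Prop :=
  f x ≠ x ∧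
    ∃ g : ℝ → X, ContinuousOn g (Icc 0 1) ∧ InjOn g (Icc 0 1) ∧
      g 0 = x ∧ g 1 = f x ∧ γ = g '' Icc 0 1 ∧
      ((⇑f '' γ) ∩ γ = {f x} ∨ ((⇑f '' γ) ∩ γ = {x, f x} ∧ f (f x) = x))

/-- An `N`-translation arc for `f` based at `x` (for `N = 1` this is just a translation arc). -/
def IsNTranslationArc (f : X ≃ₜ X) (N : ℕ) (γ : Set X) (x : X) : Prop :=
  IsTranslationArc f γ x ∧
    (2 ≤ N →
      (∀ k : ℕ, 2 ≤ k → k ≤ N - 1 → (⇑f)^[k] '' γ ∩ γ = ∅) ∧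
        ((⇑f)^[N] '' γ ∩ γ = ∅ ∨ ((⇑f)^[N] '' γ ∩ γ = {x} ∧ (⇑f)^[N + 1] x = x)))

/-- An ∞-translation arc: an `N`-translation arc for every `N ≥ 1`. -/
def IsInfTranslationArc (f : X ≃ₜ X) (γ : Set X) (x : X) : Prop :=
  ∀ N : ℕ, 1 ≤ N → IsNTranslationArc f N γ x

/-- A nonwandering homeomorphism. -/
def IsNonwanderingMap (f : X → X) : Prop :=
  ∀ V : Set X, IsOpen V → V.Nonempty → ∃ n : ℕ, 1 ≤ n ∧ (f^[n] '' V ∩ V).Nonempty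

/-- A loop contained in `A` which is not null-homotopic in `V`. -/
def IsEssentialLoopIn (V A : Set X) : Prop :=
  ∃ (z : ↥V) (δ : Path z z), (∀ t : unitInterval, (↑(δ t) : X) ∈ A) ∧
    ¬ δ.Homotopic (Path.refl z)

/-- An annular continuum: a continuum with an open annular neighborhood `V` such that `V ∖ K`
has exactly two components, each essential in `V`. -/
def IsAnnularContinuum (K : Set X) : Prop :=
  IsCompact K ∧ IsConnected K ∧ K.Nontrivial ∧
    ∃ V : Set X, IsOpen V ∧ K ⊆ V ∧
      Nonempty (↥V ≃ₜ AddCircle (1 : ℝ) × ↥(Ioo (0 : ℝ) 1)) ∧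
      ∃ D₁ D₂ : Set X, HasTwoComps (V \ K) D₁ D₂ ∧
        IsEssentialLoopIn V D₁ ∧ IsEssentialLoopIn V D₂

/-- A set contractible in the ambient surface: it has an open neighborhood homeomorphic to the
plane. -/
def ContractibleInSurface (K : Set X) : Prop :=
  ∃ W : Set X, IsOpen W ∧ K ⊆ W ∧ Nonempty (↥W ≃ₜ (ℝ × ℝ))

/-- `α ∈ ℝ/ℤ` is rational. -/
def IsRationalAC (α : AddCircle (1 : ℝ)) : Prop := ∃ r : ℚ, α = ((r : ℝ) : AddCircle (1 : ℝ))

/-- The constant `q(α,g)`: the smallest positive integer `q` with `‖qα‖ = 0` if `α` is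
rational, and `(2g+1)‖qα‖ < ‖α‖` if `α` is irrational. -/
def qConst (α : AddCircle (1 : ℝ)) (g : ℕ) : ℕ :=
  sInf {q : ℕ | 0 < q ∧
    ((IsRationalAC α ∧ ‖q • α‖ = 0) ∨
      (¬IsRationalAC α ∧ ((2 * g + 1 : ℕ) : ℝ) * ‖q • α‖ < ‖α‖))}

namespace PrimeEnds

open Complex Metric ComplexConjugate

/-! ### The Riemann mapping theorem -/

/-- `F` is a univalent function from `U` to the unit disc. -/
structure UnivalentToDisc (U : Set ℂ) (F : ℂ → ℂ) : Prop where
  diff : DifferentiableOn ℂ F U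
  maps : MapsTo F U (ball 0 1)
  inj : InjOn F U
  deriv_ne : ∀ z ∈ U, deriv F z ≠ 0

/-- The disc automorphism sending `c` to `0`. -/
def discShift (c z : ℂ) : ℂ := (z - c) / (1 - conj c * z)

lemma one_sub_conj_mul_ne_zero {c z : ℂ} (hc : ‖c‖ < 1) (hz : ‖z‖ < 1) :
    1 - conj c * z ≠ 0 := by
  intro h
  have h1 : ‖conj c * z‖ = 1 := by rw [← sub_eq_zero.mp h]; simp
  rw [norm_mul, RCLike.norm_conj] at h1
  nlinarith [norm_nonneg c, norm_nonneg z]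

lemma hasDerivAt_discShift {c z : ℂ} (hc : ‖c‖ < 1) (hz : ‖z‖ < 1) :
    HasDerivAt (discShift c) ((1 - conj c * c) / (1 - conj c * z) ^ 2) z := by
  have h := ((hasDerivAt_id z).sub_const c).div
    (((hasDerivAt_id z).const_mul (conj c)).const_sub 1) (one_sub_conj_mul_ne_zero hc hz)
  refine h.congr_deriv ?_
  simp only [id]
  congr 1
  ring

lemma norm_discShift_lt_one {c z : ℂ} (hc : ‖c‖ < 1) (hz : ‖z‖ < 1) : ‖discShift c z‖ < 1 := by
  have h0 := one_sub_conj_mul_ne_zero hc hz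
  rw [discShift, norm_div, div_lt_one (norm_pos_iff.mpr h0)]
  refine lt_of_pow_lt_pow_left₀ 2 (norm_nonneg _) ?_
  rw [← Complex.normSq_eq_norm_sq, ← Complex.normSq_eq_norm_sq]
  have hc' : Complex.normSq c < 1 := by
    rw [Complex.normSq_eq_norm_sq]; nlinarith [norm_nonneg c]
  have hz' : Complex.normSq z < 1 := by
    rw [Complex.normSq_eq_norm_sq]; nlinarith [norm_nonneg z]
  simp only [Complex.normSq_apply, Complex.sub_re, Complex.sub_im, Complex.mul_re, Complex.mul_im,
    Complex.conj_re, Complex.conj_im, Complex.one_re, Complex.one_im] at *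
  nlinarith [mul_pos (sub_pos.2 hc') (sub_pos.2 hz')]

lemma discShift_injOn {c : ℂ} (hc : ‖c‖ < 1) : InjOn (discShift c) (ball 0 1) := by
  intro x hx y hy h
  rw [mem_ball_zero_iff] at hx hy
  rw [discShift, discShift, div_eq_div_iff (one_sub_conj_mul_ne_zero hc hx)
    (one_sub_conj_mul_ne_zero hc hy)] at h
  have h1 : (x - y) * (1 - conj c * c) = 0 := by linear_combination h
  rcases mul_eq_zero.mp h1 with h2 | h2
  · exact sub_eq_zero.mp h2
  · exact absurd h2 (one_sub_conj_mul_ne_zero hc hc)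

lemma one_sub_conj_mul_self (c : ℂ) : 1 - conj c * c = ((1 - ‖c‖ ^ 2 : ℝ) : ℂ) := by
  rw [mul_comm, Complex.mul_conj, Complex.normSq_eq_norm_sq]
  push_cast
  ring

lemma hasDerivAt_of_sq_eq {U : Set ℂ} (hU : IsOpen U) {F H : ℂ → ℂ} (hH : ContinuousOn H U)
    (hsq : ∀ z, H z ^ 2 = F z) {z d : ℂ} (hz : z ∈ U) (h0 : H z ≠ 0) (hF : HasDerivAt F d z) :
    HasDerivAt H (d / (2 * H z)) z := by
  have hne : 2 * H z ≠ 0 := mul_ne_zero two_ne_zero h0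
  have hinv : HasStrictDerivAt (fun w : ℂ => w ^ 2) (2 * H z) (H z) := by
    simpa using hasStrictDerivAt_pow 2 (H z)
  have hloc := hinv.eventually_left_inverse (f' := 2 * H z) hne
  have h1 : HasDerivAt (hinv.localInverse _ _ _ hne) (2 * H z)⁻¹ (F z) := by
    simpa only [hsq] using (hinv.to_localInverse hne).hasDerivAt
  have h2 := h1.comp z hF
  have h3 : H =ᶠ[𝓝 z] (hinv.localInverse _ _ _ hne) ∘ F := by
    filter_upwards [(hH.continuousAt (hU.mem_nhds hz)).eventually hloc] with y hy
    rw [Function.comp_apply, ← hsq y]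
    exact hy.symm
  refine (h2.congr_of_eventuallyEq h3).congr_deriv ?_
  rw [div_eq_mul_inv, mul_comm]

/-- On a simply connected open set omitting `a` there is a branch of the square root of `z - a`,
whose values stay away from some point. -/
lemma exists_sqrt_sub {U : Set ℂ} (hU : IsOpen U) (hUc : IsSimplyConnected U) {a : ℂ} (ha : a ∉ U) :
    ∃ s : ℂ → ℂ, (∀ z, s z ^ 2 = z - a) ∧ (∀ z ∈ U, DifferentiableAt ℂ s z ∧ deriv s z ≠ 0) ∧
      ∃ w : ℂ, ∃ ε > 0, ∀ z ∈ U, ε ≤ ‖s z - w‖ := by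
  obtain ⟨s, hsc, hs⟩ := Complex.exists_continuousOn_pow_eq hUc hU
    (g := fun z => z - a) (by fun_prop)
    (by rintro ⟨z, hz, hz0⟩; exact ha (sub_eq_zero.mp hz0 ▸ hz)) two_ne_zero
  have hs0 : ∀ z ∈ U, s z ≠ 0 := fun z hz h0 => ha (by
    have := hs z
    rw [h0, zero_pow two_ne_zero, eq_comm, sub_eq_zero] at this
    exact this ▸ hz)
  have hd : ∀ z ∈ U, HasDerivAt s (1 / (2 * s z)) z := fun z hz =>
    hasDerivAt_of_sq_eq hU hsc hs hz (hs0 z hz) ((hasDerivAt_id z).sub_const a)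
  have hd0 : ∀ z ∈ U, deriv s z ≠ 0 := fun z hz => by
    rw [(hd z hz).deriv]
    exact div_ne_zero one_ne_zero (mul_ne_zero two_ne_zero (hs0 z hz))
  refine ⟨s, hs, fun z hz => ⟨(hd z hz).differentiableAt, hd0 z hz⟩, ?_⟩
  obtain ⟨z₁, hz₁⟩ := hUc.nonempty
  have hsa : AnalyticAt ℂ s z₁ :=
    DifferentiableOn.analyticAt (fun z hz => (hd z hz).differentiableAt.differentiableWithinAt)
      (hU.mem_nhds hz₁)
  have hmap := hsa.hasStrictDerivAt.map_nhds_eq (hd0 z₁ hz₁)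
  have himg : s '' U ∈ 𝓝 (s z₁) := hmap ▸ image_mem_map (hU.mem_nhds hz₁)
  obtain ⟨ε, hε, hball⟩ := Metric.mem_nhds_iff.mp himg
  refine ⟨-s z₁, ε, hε, fun z hz => ?_⟩
  by_contra hlt
  rw [not_le, sub_neg_eq_add] at hlt
  obtain ⟨z', hz', hzz⟩ := hball (show -s z ∈ ball (s z₁) ε by
    rwa [mem_ball, dist_eq_norm, ← norm_neg, neg_sub', neg_neg, sub_neg_eq_add])
  have h1 := hs z'
  rw [hzz, neg_sq, hs z, sub_left_inj] at h1
  rw [← h1] at hzz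
  exact hs0 z hz (by linear_combination (1 / 2 : ℂ) * hzz)

namespace UnivalentToDisc

variable {U : Set ℂ} {F : ℂ → ℂ}

lemma hasDerivAt (h : UnivalentToDisc U F) (hU : IsOpen U) {z : ℂ} (hz : z ∈ U) :
    HasDerivAt F (deriv F z) z :=
  (h.diff.differentiableAt (hU.mem_nhds hz)).hasDerivAt

lemma norm_lt (h : UnivalentToDisc U F) {z : ℂ} (hz : z ∈ U) : ‖F z‖ < 1 :=
  mem_ball_zero_iff.mp (h.maps hz)

lemma hasDerivAt_discShift_comp (h : UnivalentToDisc U F) (hU : IsOpen U) {c : ℂ} (hc : ‖c‖ < 1)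
    {z : ℂ} (hz : z ∈ U) :
    HasDerivAt (discShift c ∘ F) ((1 - conj c * c) / (1 - conj c * F z) ^ 2 * deriv F z) z :=
  (PrimeEnds.hasDerivAt_discShift hc (h.norm_lt hz)).comp z (h.hasDerivAt hU hz)

lemma discShift_comp (h : UnivalentToDisc U F) (hU : IsOpen U) {c : ℂ} (hc : ‖c‖ < 1) :
    UnivalentToDisc U (discShift c ∘ F) where
  diff z hz := (h.hasDerivAt_discShift_comp hU hc hz).differentiableAt.differentiableWithinAt
  maps z hz := mem_ball_zero_iff.mpr (norm_discShift_lt_one hc (h.norm_lt hz))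
  inj := (discShift_injOn hc).comp h.inj h.maps
  deriv_ne z hz := by
    rw [(h.hasDerivAt_discShift_comp hU hc hz).deriv]
    exact mul_ne_zero (div_ne_zero (one_sub_conj_mul_ne_zero hc hc)
      (pow_ne_zero _ (one_sub_conj_mul_ne_zero hc (h.norm_lt hz)))) (h.deriv_ne z hz)

/-- A nowhere vanishing univalent function to the disc has a univalent square root. -/
lemma exists_sqrt (h : UnivalentToDisc U F) (hU : IsOpen U) (hUc : IsSimplyConnected U)
    (h0 : 0 ∉ F '' U) :
    ∃ H : ℂ → ℂ, UnivalentToDisc U H ∧ (∀ z, H z ^ 2 = F z) ∧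
      ∀ z ∈ U, 2 * H z * deriv H z = deriv F z := by
  obtain ⟨H, hHc, hH⟩ := Complex.exists_continuousOn_pow_eq hUc hU h.diff.continuousOn h0
    two_ne_zero
  have hH0 : ∀ z ∈ U, H z ≠ 0 := fun z hz hz0 => h0 ⟨z, hz, by rw [← hH z, hz0]; simp⟩
  have hd : ∀ z ∈ U, HasDerivAt H (deriv F z / (2 * H z)) z := fun z hz =>
    hasDerivAt_of_sq_eq hU hHc hH hz (hH0 z hz) (h.hasDerivAt hU hz)
  refine ⟨H, ⟨fun z hz => (hd z hz).differentiableAt.differentiableWithinAt, fun z hz => ?_,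
    fun x hx y hy hxy => h.inj hx hy (by rw [← hH, ← hH, hxy]), fun z hz => ?_⟩, hH, fun z hz => ?_⟩
  · have := h.norm_lt hz
    rw [← hH z, norm_pow] at this
    rw [mem_ball_zero_iff]
    by_contra hge
    nlinarith [not_lt.mp hge]
  · rw [(hd z hz).deriv]
    exact div_ne_zero (h.deriv_ne z hz) (mul_ne_zero two_ne_zero (hH0 z hz))
  · rw [(hd z hz).deriv]
    field_simp [hH0 z hz]

/-- Koebe's expansion step. -/
lemma exists_norm_deriv_lt (h : UnivalentToDisc U F) (hU : IsOpen U) (hUc : IsSimplyConnected U)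
    {z₀ : ℂ} (hz₀ : z₀ ∈ U) (hF0 : F z₀ = 0) {w : ℂ} (hw : w ∈ ball (0 : ℂ) 1) (hwF : w ∉ F '' U) :
    ∃ G : ℂ → ℂ, UnivalentToDisc U G ∧ G z₀ = 0 ∧ ‖deriv F z₀‖ < ‖deriv G z₀‖ := by
  rw [mem_ball_zero_iff] at hw
  have hm := h.discShift_comp hU hw
  obtain ⟨H, hH, hsq, hder⟩ := hm.exists_sqrt hU hUc (by
    rintro ⟨z, hz, hz0⟩
    rw [Function.comp_apply, discShift, div_eq_zero_iff] at hz0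
    rcases hz0 with hz0 | hz0
    · exact hwF ⟨z, hz, sub_eq_zero.mp hz0⟩
    · exact one_sub_conj_mul_ne_zero hw (h.norm_lt hz) hz0)
  have hb : ‖H z₀‖ < 1 := hH.norm_lt hz₀
  refine ⟨discShift (H z₀) ∘ H, hH.discShift_comp hU hb, by simp [discShift], ?_⟩
  have hb2 : ‖H z₀‖ ^ 2 = ‖w‖ := by
    rw [← norm_pow, hsq, Function.comp_apply, hF0]; simp [discShift]
  have hd1 := hder z₀ hz₀
  rw [(h.hasDerivAt_discShift_comp hU hw hz₀).deriv, hF0, one_sub_conj_mul_self] at hd1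
  rw [(hH.hasDerivAt_discShift_comp hU hb hz₀).deriv, one_sub_conj_mul_self]
  set b := ‖H z₀‖ with hbdef
  have hb0 : 0 < b := by
    rcases (norm_nonneg (H z₀)).eq_or_lt with h0 | h0
    · exfalso
      have hw0 : w = 0 := by
        rw [← norm_eq_zero, ← hb2, hbdef, ← h0]
        simp
      exact hwF ⟨z₀, hz₀, by rw [hF0, hw0]⟩
    · exact h0
  have hd2 := congrArg norm hd1
  simp only [norm_mul, norm_div, norm_pow, mul_zero, sub_zero, one_pow, div_one,
    Complex.norm_real, ← hbdef, ← hb2, Complex.norm_ofNat] at hd2 ⊢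
  have p1 : (0 : ℝ) < 1 - b ^ 2 := by nlinarith
  have p2 : (0 : ℝ) < 1 - (b ^ 2) ^ 2 := by nlinarith
  rw [Real.norm_of_nonneg p2.le] at hd2
  rw [Real.norm_of_nonneg p1.le]
  have hdF : 0 < ‖deriv F z₀‖ := norm_pos_iff.mpr (h.deriv_ne z₀ hz₀)
  have e : (1 - b ^ 2) / (1 - b ^ 2) ^ 2 * ‖deriv H z₀‖ = ‖deriv H z₀‖ / (1 - b ^ 2) := by
    field_simp
  rw [e, lt_div_iff₀ p1]
  have : 2 * b * (‖deriv F z₀‖ * (1 - b ^ 2)) < 2 * b * ‖deriv H z₀‖ := by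
    rw [hd2]
    have : 0 < ‖deriv F z₀‖ * (1 - b ^ 2) * (1 - b) ^ 2 := by
      have : 0 < 1 - b := by linarith
      positivity
    nlinarith
  exact lt_of_mul_lt_mul_left this (by positivity)

end UnivalentToDisc

lemma exists_univalentToDisc {U : Set ℂ} (hU : IsOpen U) (hUc : IsSimplyConnected U)
    (hne : U ≠ univ) : ∃ F, UnivalentToDisc U F := by
  obtain ⟨a, ha⟩ := (ne_univ_iff_exists_notMem U).mp hne
  obtain ⟨s, hs, hd, w, ε, hε, hw⟩ := exists_sqrt_sub hU hUc ha
  have h0 : ∀ z ∈ U, s z - w ≠ 0 := fun z hz h => by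
    have := hw z hz
    rw [h, norm_zero] at this
    linarith
  have hder : ∀ z ∈ U, HasDerivAt (fun z => (ε / 2 : ℂ) * (s z - w)⁻¹)
      ((ε / 2 : ℂ) * (-deriv s z / (s z - w) ^ 2)) z := fun z hz =>
    (((hd z hz).1.hasDerivAt.sub_const w).inv (h0 z hz)).const_mul _
  have hε0 : (ε / 2 : ℂ) ≠ 0 := by
    exact_mod_cast (by positivity : ε / 2 ≠ 0)
  refine ⟨fun z => (ε / 2 : ℂ) * (s z - w)⁻¹,
    fun z hz => (hder z hz).differentiableAt.differentiableWithinAt, fun z hz => ?_,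
    fun x hx y hy hxy => ?_, fun z hz => ?_⟩
  · rw [mem_ball_zero_iff, norm_mul, norm_inv, ← div_eq_mul_inv,
      div_lt_one (norm_pos_iff.mpr (h0 z hz))]
    have : ‖(ε / 2 : ℂ)‖ = ε / 2 := by
      rw [norm_div, Complex.norm_real, Real.norm_of_nonneg hε.le]; simp
    rw [this]
    linarith [hw z hz]
  · have h1 : s x = s y := by
      have := inv_injective (mul_left_cancel₀ hε0 hxy)
      linear_combination this
    have := hs x
    rw [h1, hs y, sub_left_inj] at this
    exact this.symm
  · rw [(hder z hz).deriv]
    exact mul_ne_zero hε0 (div_ne_zero (neg_ne_zero.mpr (hd z hz).2) (pow_ne_zero _ (h0 z hz)))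

/-- Hurwitz's theorem: a locally uniform limit of nowhere vanishing holomorphic functions vanishes
nowhere or everywhere. -/
lemma eqOn_zero_of_tendstoLocallyUniformlyOn {ι : Type*} {l : Filter ι} [l.NeBot] {U : Set ℂ}
    (hU : IsOpen U) (hUc : IsPreconnected U) {F : ι → ℂ → ℂ} {G : ℂ → ℂ}
    (hd : ∀ n, DifferentiableOn ℂ (F n) U) (h0 : ∀ n, ∀ z ∈ U, F n z ≠ 0)
    (hl : TendstoLocallyUniformlyOn F G l U) {z₀ : ℂ} (hz₀ : z₀ ∈ U) (hG : G z₀ = 0) :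
    EqOn G 0 U := by
  have hGd := hl.differentiableOn (Eventually.of_forall hd) hU
  have hGa := hGd.analyticOnNhd hU
  rcases (hGa z₀ hz₀).eventually_eq_zero_or_eventually_ne_zero with h | h
  · exact hGa.eqOn_zero_of_preconnected_of_eventuallyEq_zero hUc hz₀ h
  exfalso
  rw [eventually_nhdsWithin_iff] at h
  obtain ⟨r, hr, hrs⟩ := Metric.eventually_nhds_iff_ball.mp (h.and (hU.mem_nhds hz₀))
  have hr2 : 0 < r / 2 := by positivity
  have hsub : closedBall z₀ (r / 2) ⊆ U := fun y hy =>
    (hrs y (closedBall_subset_ball (by linarith) hy)).2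
  have hcpt : IsCompact (sphere z₀ (r / 2)) := isCompact_sphere _ _
  have hne : (sphere z₀ (r / 2)).Nonempty := NormedSpace.sphere_nonempty.mpr hr2.le
  obtain ⟨m, hm, hmin⟩ := hcpt.exists_isMinOn hne
    ((hGd.continuousOn.mono (sphere_subset_closedBall.trans hsub)).norm)
  have hmpos : 0 < ‖G m‖ := by
    refine norm_pos_iff.mpr ((hrs m ?_).1 ?_)
    · exact closedBall_subset_ball (by linarith) (sphere_subset_closedBall hm)
    · exact ne_of_mem_sphere hm hr2.ne'
  have hunif := (tendstoLocallyUniformlyOn_iff_forall_isCompact hU).mp hl _ hsub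
    (isCompact_closedBall _ _)
  rw [Metric.tendstoUniformlyOn_iff] at hunif
  obtain ⟨n, hn⟩ := (hunif (‖G m‖ / 2) (by positivity)).exists
  have hbound : ∀ z ∈ frontier (ball z₀ (r / 2)), ‖(F n z)⁻¹‖ ≤ (‖G m‖ / 2)⁻¹ := by
    intro z hz
    rw [frontier_ball _ hr2.ne'] at hz
    have h1 := hn z (sphere_subset_closedBall hz)
    have h2 : ‖G m‖ ≤ ‖G z‖ := hmin hz
    rw [norm_inv]
    apply inv_anti₀ (by positivity)
    rw [dist_eq_norm] at h1
    have := norm_sub_norm_le (G z) (F n z)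
    linarith
  have hdc : DiffContOnCl ℂ (fun z => (F n z)⁻¹) (ball z₀ (r / 2)) := by
    apply DifferentiableOn.diffContOnCl
    rw [closure_ball _ hr2.ne']
    exact ((hd n).mono hsub).inv fun z hz => h0 n z (hsub hz)
  have := Complex.norm_le_of_forall_mem_frontier_norm_le isBounded_ball hdc hbound
    (subset_closure (mem_ball_self hr2))
  rw [norm_inv, inv_le_inv₀ (norm_pos_iff.mpr (h0 n z₀ hz₀)) (by positivity)] at this
  have h3 := hn z₀ (mem_closedBall_self hr2.le)
  rw [hG, dist_zero_left] at h3
  linarith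

/-- Montel's theorem, along an ultrafilter. -/
lemma exists_tendstoLocallyUniformlyOn {ι : Type*} (l : Ultrafilter ι) {U : Set ℂ}
    (hU : IsOpen U) {F : ι → ℂ → ℂ} (hd : ∀ n, DifferentiableOn ℂ (F n) U)
    (hb : ∀ n, MapsTo (F n) U (ball 0 1)) :
    ∃ G : ℂ → ℂ, TendstoLocallyUniformlyOn F G l U ∧
      (∀ z ∈ U, Tendsto (fun n => F n z) l (𝓝 (G z))) ∧ MapsTo G U (closedBall 0 1) := by
  have hex : ∀ z, ∃ w, z ∈ U → w ∈ closedBall (0 : ℂ) 1 ∧ Tendsto (fun n => F n z) l (𝓝 w) := by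
    intro z
    by_cases hz : z ∈ U
    · obtain ⟨w, hw, hw2⟩ := (isCompact_closedBall (0 : ℂ) 1).ultrafilter_le_nhds
        (l.map fun n => F n z) (by
          rw [Ultrafilter.coe_map, le_principal_iff]
          exact Filter.mem_map.mpr (Filter.univ_mem' fun n => ball_subset_closedBall (hb n hz)))
      exact ⟨w, fun _ => ⟨hw, hw2⟩⟩
    · exact ⟨0, fun h => absurd h hz⟩
  choose G hG using hex
  refine ⟨G, ?_, fun z hz => (hG z hz).2, fun z hz => (hG z hz).1⟩
  rw [Metric.tendstoLocallyUniformlyOn_iff]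
  intro ε hε z hz
  obtain ⟨r, hr, hrU⟩ := Metric.isOpen_iff.mp hU z hz
  have hderiv : ∀ n, ∀ y ∈ ball z (r / 2), ‖deriv (F n) y‖ ≤ 1 / (r / 4) := by
    intro n y hy
    have hsub : closedBall y (r / 4) ⊆ U := by
      intro x hx
      apply hrU
      rw [mem_ball] at hy ⊢
      rw [mem_closedBall] at hx
      linarith [dist_triangle x y z]
    apply Complex.norm_deriv_le_of_forall_mem_sphere_norm_le (by positivity)
    · apply DifferentiableOn.diffContOnCl
      rw [closure_ball _ (by positivity)]
      exact (hd n).mono hsub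
    · intro x hx
      exact (mem_ball_zero_iff.mp (hb n (hsub (sphere_subset_closedBall hx)))).le
  have hlip : ∀ n, ∀ y ∈ ball z (r / 2), dist (F n y) (F n z) ≤ 1 / (r / 4) * dist y z := by
    intro n y hy
    rw [dist_eq_norm, dist_eq_norm]
    refine Convex.norm_image_sub_le_of_norm_deriv_le (s := ball z (r / 2)) (fun x hx => ?_)
      (hderiv n) (convex_ball _ _) (mem_ball_self (by positivity)) hy
    exact (hd n).differentiableAt (hU.mem_nhds (hrU (ball_subset_ball (by linarith) hx)))
  have hGlip : ∀ y ∈ ball z (r / 2), dist (G y) (G z) ≤ 1 / (r / 4) * dist y z := by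
    intro y hy
    have hyU : y ∈ U := hrU (ball_subset_ball (by linarith) hy)
    exact le_of_tendsto ((hG y hyU).2.dist (hG z hz).2) (Eventually.of_forall fun n => hlip n y hy)
  refine ⟨ball z (min (r / 2) (ε * r / 16)), ?_, ?_⟩
  · exact mem_nhdsWithin_of_mem_nhds (ball_mem_nhds _ (by positivity))
  · have h1 := Metric.tendsto_nhds.mp (hG z hz).2 (ε / 4) (by positivity)
    filter_upwards [h1] with n hn y hy
    have hy1 : y ∈ ball z (r / 2) := ball_subset_ball (min_le_left _ _) hy
    have hy2 : dist y z < ε * r / 16 := lt_of_lt_of_le hy (min_le_right _ _)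
    have h2 := hlip n y hy1
    have h3 := hGlip y hy1
    have h4 : 1 / (r / 4) * dist y z ≤ ε / 4 := by
      rw [one_div, inv_mul_le_iff₀ (by positivity)]
      nlinarith
    have h5 := dist_triangle4_left (G y) (F n y) (G z) (F n z)
    rw [dist_comm (F n z) (G z)] at hn
    have := dist_triangle4 (G y) (G z) (F n z) (F n y)
    rw [dist_comm (F n z) (F n y)] at this
    linarith

/-- The Riemann mapping theorem. -/
theorem exists_univalentToDisc_image_eq {U : Set ℂ} (hU : IsOpen U) (hUc : IsSimplyConnected U)
    (hne : U ≠ univ) : ∃ F, UnivalentToDisc U F ∧ F '' U = ball 0 1 := by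
  obtain ⟨z₀, hz₀⟩ := hUc.nonempty
  have hpre : IsPreconnected U := hUc.isPathConnected.isConnected.isPreconnected
  set A : Set ℝ := {t | ∃ F, UnivalentToDisc U F ∧ F z₀ = 0 ∧ t = ‖deriv F z₀‖} with hA
  have hAne : A.Nonempty := by
    obtain ⟨f, hf⟩ := exists_univalentToDisc hU hUc hne
    exact ⟨_, discShift (f z₀) ∘ f, hf.discShift_comp hU (hf.norm_lt hz₀), by simp [discShift], rfl⟩
  obtain ⟨r, hr, hrU⟩ := Metric.nhds_basis_closedBall.mem_iff.mp (hU.mem_nhds hz₀)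
  have hAb : BddAbove A := by
    refine ⟨1 / r, ?_⟩
    rintro _ ⟨F, hF, -, rfl⟩
    apply Complex.norm_deriv_le_of_forall_mem_sphere_norm_le hr
    · apply DifferentiableOn.diffContOnCl
      rw [closure_ball _ hr.ne']
      exact hF.diff.mono hrU
    · exact fun x hx => (hF.norm_lt (hrU (sphere_subset_closedBall hx))).le
  obtain ⟨u, -, hu, huA⟩ := exists_seq_tendsto_sSup hAne hAb
  choose F hF hF0 hFu using huA
  let l : Ultrafilter ℕ := Filter.hyperfilter ℕ
  have hl : (l : Filter ℕ) ≤ atTop := Nat.hyperfilter_le_atTop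
  obtain ⟨G, hG, hGp, hGm⟩ := exists_tendstoLocallyUniformlyOn l hU (fun n => (hF n).diff)
    fun n => (hF n).maps
  have hGd := hG.differentiableOn (Eventually.of_forall fun n => (hF n).diff) hU
  have hGderiv := hG.deriv (Eventually.of_forall fun n => (hF n).diff) hU
  have hG0 : G z₀ = 0 := tendsto_nhds_unique (hGp z₀ hz₀) (by simp [hF0])
  have hGS : ‖deriv G z₀‖ = sSup A := by
    refine tendsto_nhds_unique ((hGderiv.tendsto_at hz₀).norm) ?_
    simpa only [Function.comp_apply, ← hFu] using hu.mono_left hl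
  obtain ⟨t, F₁, hF₁, hF₁0, ht⟩ := hAne
  have hSpos : 0 < sSup A := lt_of_lt_of_le (norm_pos_iff.mpr (hF₁.deriv_ne z₀ hz₀))
    (le_csSup hAb ⟨F₁, hF₁, hF₁0, rfl⟩)
  have hGder0 : deriv G z₀ ≠ 0 := norm_pos_iff.mp (hGS ▸ hSpos)
  have hGa := hGd.analyticOnNhd hU
  have hnonconst : ∀ c, ¬ ∀ᶠ z in 𝓝 z₀, G z = c := fun c hc => hGder0 (by
    rw [EventuallyEq.deriv_eq (f := fun _ => c) hc]; simp)
  have hderiv_ne : ∀ z ∈ U, deriv G z ≠ 0 := by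
    intro z hz hz0
    exact hGder0 (eqOn_zero_of_tendstoLocallyUniformlyOn hU hpre
      (fun n => (hF n).diff.deriv hU) (fun n => (hF n).deriv_ne) hGderiv hz hz0 hz₀)
  have hinj : InjOn G U := by
    intro x hx y hy hxy
    by_contra hxney
    obtain ⟨s, hs, hsU⟩ := Metric.isOpen_iff.mp (hU.inter isOpen_compl_singleton) y
      ⟨hy, fun h : y = x => hxney h.symm⟩
    have hunif : TendstoLocallyUniformlyOn (fun n z => F n z - F n x) (fun z => G z - G x) l
        (ball y s) := by
      have h1 := hG.mono (fun z hz => (hsU hz).1 : ball y s ⊆ U)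
      have h2 : TendstoLocallyUniformlyOn (fun n _ => F n x) (fun _ : ℂ => G x) l (ball y s) := by
        apply TendstoUniformlyOn.tendstoLocallyUniformlyOn
        exact (hGp x hx).tendstoUniformlyOn_const _
      exact h1.sub h2
    have h0 := eqOn_zero_of_tendstoLocallyUniformlyOn isOpen_ball
      (convex_ball y s).isPreconnected
      (fun n => ((hF n).diff.mono fun z hz => (hsU hz).1).sub_const _)
      (fun n z hz h => (hsU hz).2 ((hF n).inj (hsU hz).1 hx (sub_eq_zero.mp h))) hunif
      (mem_ball_self hs) (sub_eq_zero.mpr hxy.symm)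
    have hev : (fun z => G z - G x) =ᶠ[𝓝 y] 0 :=
      h0.eventuallyEq_of_mem (ball_mem_nhds y hs)
    have := (AnalyticOnNhd.sub hGa analyticOnNhd_const
      ).eqOn_zero_of_preconnected_of_eventuallyEq_zero hpre hy hev
    refine hnonconst (G x) ?_
    filter_upwards [hU.mem_nhds hz₀] with z hz
    exact sub_eq_zero.mp (this hz)
  have hmaps : MapsTo G U (ball 0 1) := by
    rcases hGa.is_constant_or_isOpen hpre with ⟨c, hc⟩ | ho
    · exact absurd (eventually_of_mem (hU.mem_nhds hz₀) hc) (hnonconst c)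
    · have : G '' U ⊆ interior (closedBall 0 1) :=
        interior_maximal hGm.image_subset (ho U subset_rfl hU)
      rw [interior_closedBall _ one_ne_zero] at this
      exact fun z hz => this (mem_image_of_mem G hz)
  have hGu : UnivalentToDisc U G := ⟨hGd, hmaps, hinj, hderiv_ne⟩
  refine ⟨G, hGu, subset_antisymm hmaps.image_subset ?_⟩
  intro w hw
  by_contra hwG
  obtain ⟨H, hH, hH0, hlt⟩ := hGu.exists_norm_deriv_lt hU hUc hz₀ hG0 hw hwG
  exact absurd (le_csSup hAb ⟨H, hH, hH0, rfl⟩) (not_le.mpr (hGS ▸ hlt))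

/-! ### Boundary behaviour of the Riemann map -/

/-- `f` is a Riemann map onto `U`, written in terms of the bounded univalent function `k`. -/
structure DiscParam (U : Set ℂ) (f k : ℂ → ℂ) (a w C : ℂ) : Prop where
  contOn : ContinuousOn f (ball 0 1)
  injOn : InjOn f (ball 0 1)
  image_eq : f '' ball 0 1 = U
  isOpen_image : ∀ V, IsOpen V → V ⊆ ball 0 1 → IsOpen (f '' V)
  diff : DifferentiableOn ℂ k (ball 0 1)
  inj : InjOn k (ball 0 1)
  bound : ∀ z ∈ ball (0 : ℂ) 1, ‖k z‖ ≤ ‖C‖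
  ne_zero : ∀ z ∈ ball (0 : ℂ) 1, k z ≠ 0
  eq : ∀ z ∈ ball (0 : ℂ) 1, f z = a + (1 / k z + w) ^ 2

theorem exists_discParam {U : Set ℂ} (hU : IsOpen U) (hUc : IsSimplyConnected U)
    (hne : U ≠ univ) : ∃ f k a w C, DiscParam U f k a w C := by
  obtain ⟨a, ha⟩ := (ne_univ_iff_exists_notMem U).mp hne
  obtain ⟨s, hs, hd, w, ε, hε, hw⟩ := exists_sqrt_sub hU hUc ha
  obtain ⟨F, hF, hFU⟩ := exists_univalentToDisc_image_eq hU hUc hne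
  set f : ℂ → ℂ := Function.invFunOn F U with hf
  have hfU : ∀ z ∈ ball (0 : ℂ) 1, f z ∈ U := fun z hz =>
    Function.invFunOn_mem (by rw [← hFU] at hz; exact hz)
  have hFf : ∀ z ∈ ball (0 : ℂ) 1, F (f z) = z := fun z hz =>
    Function.invFunOn_eq (by rw [← hFU] at hz; exact hz)
  have hfF : ∀ z ∈ U, f (F z) = z := fun z hz =>
    hF.inj (hfU _ (hF.maps hz)) hz (hFf _ (hF.maps hz))
  have hopen : ∀ V, IsOpen V → V ⊆ ball 0 1 → IsOpen (f '' V) := by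
    intro V hV hVb
    have : f '' V = U ∩ F ⁻¹' V := by
      ext z
      constructor
      · rintro ⟨y, hy, rfl⟩
        exact ⟨hfU _ (hVb hy), by rw [mem_preimage, hFf _ (hVb hy)]; exact hy⟩
      · rintro ⟨hz, hzV⟩
        exact ⟨F z, hzV, hfF z hz⟩
    rw [this]
    exact hF.diff.continuousOn.isOpen_inter_preimage hU hV
  have hFopen : ∀ V, IsOpen V → V ⊆ U → IsOpen (F '' V) := by
    intro V hV hVU
    rw [isOpen_iff_mem_nhds]
    rintro _ ⟨z, hz, rfl⟩
    have han := (hF.diff.analyticOnNhd hU) z (hVU hz)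
    rw [← HasStrictDerivAt.map_nhds_eq han.hasStrictDerivAt (hF.deriv_ne z (hVU hz))]
    exact image_mem_map (hV.mem_nhds hz)
  have hcont : ContinuousOn f (ball 0 1) := by
    rw [continuousOn_open_iff isOpen_ball]
    intro V hV
    have : ball 0 1 ∩ f ⁻¹' V = F '' (U ∩ V) := by
      ext z
      constructor
      · rintro ⟨hz, hzV⟩
        exact ⟨f z, ⟨hfU z hz, hzV⟩, hFf z hz⟩
      · rintro ⟨y, ⟨hy, hyV⟩, rfl⟩
        exact ⟨hF.maps hy, by rw [mem_preimage, hfF y hy]; exact hyV⟩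
    rw [this]
    exact hFopen _ (hU.inter hV) inter_subset_left
  have hfd : ∀ z ∈ ball (0 : ℂ) 1, DifferentiableAt ℂ f z := fun z hz =>
    (HasDerivAt.of_local_left_inverse (hcont.continuousAt (isOpen_ball.mem_nhds hz))
      (hF.hasDerivAt hU (hfU z hz)) (hF.deriv_ne _ (hfU z hz))
      (eventually_of_mem (isOpen_ball.mem_nhds hz) hFf)).differentiableAt
  have hfinj : InjOn f (ball 0 1) := fun x hx y hy h => by
    rw [← hFf x hx, ← hFf y hy, h]
  have h0 : ∀ z ∈ U, s z - w ≠ 0 := fun z hz h => by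
    have := hw z hz
    rw [h, norm_zero] at this
    linarith
  refine ⟨f, fun z => 1 / (s (f z) - w), a, w, ((1 / ε : ℝ) : ℂ), hcont, hfinj, ?_, hopen, ?_, ?_,
    ?_, ?_, ?_⟩
  · ext z
    exact ⟨fun ⟨y, hy, e⟩ => e ▸ hfU y hy, fun hz => ⟨F z, hF.maps hz, hfF z hz⟩⟩
  · intro z hz
    have h1 : DifferentiableAt ℂ (fun z => s (f z)) z :=
      DifferentiableAt.comp z (hd _ (hfU z hz)).1 (hfd z hz)
    exact ((differentiableAt_const _).div (h1.sub_const w)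
      (h0 _ (hfU z hz))).differentiableWithinAt
  · intro x hx y hy h
    have h1 : s (f x) = s (f y) := by
      have := inv_injective (by simpa [one_div] using h : (s (f x) - w)⁻¹ = (s (f y) - w)⁻¹)
      linear_combination this
    have h2 : f x = f y := by
      have h3 := hs (f x)
      rw [h1, hs] at h3
      linear_combination -h3
    exact hfinj hx hy h2
  · intro z hz
    rw [Complex.norm_real, Real.norm_eq_abs, abs_of_pos (by positivity), norm_div, norm_one]
    exact one_div_le_one_div_of_le hε (hw _ (hfU z hz))
  · intro z hz
    exact one_div_ne_zero (h0 _ (hfU z hz))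
  · intro z hz
    simp only [one_div_one_div, sub_add_cancel, hs]
    ring

open MeasureTheory
open scoped ENNReal

lemma lintegral_enorm_deriv_sq_lt_top {V : Set ℂ} (hV : IsOpen V) {G : ℂ → ℂ}
    (hd : DifferentiableOn ℂ G V) (hi : InjOn G V) {C : ℝ} (hb : ∀ z ∈ V, ‖G z‖ ≤ C) :
    ∫⁻ z in V, ‖deriv G z‖ₑ ^ 2 < ⊤ := by
  have hder : ∀ z ∈ V, HasFDerivWithinAt G
      ((ContinuousLinearMap.toSpanSingleton ℂ (deriv G z)).restrictScalars ℝ) V z := fun z hz =>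
    ((hd.differentiableAt (hV.mem_nhds hz)).hasDerivAt.hasFDerivAt.restrictScalars
      ℝ).hasFDerivWithinAt
  have h := lintegral_image_eq_lintegral_abs_det_fderiv_mul volume hV.measurableSet hder hi
    (fun _ => 1)
  have hlt : ∫⁻ _ in G '' V, (1 : ℝ≥0∞) < ⊤ := by
    rw [lintegral_one, Measure.restrict_apply_univ]
    refine (measure_mono ?_).trans_lt (measure_closedBall_lt_top (x := (0 : ℂ)) (r := C))
    rintro _ ⟨z, hz, rfl⟩
    exact mem_closedBall_zero_iff.mpr (hb z hz)
  rw [h] at hlt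
  convert hlt using 4 with z
  rw [mul_one, ← ofReal_norm, ← ENNReal.ofReal_pow (norm_nonneg _)]
  congr 1
  simp [ContinuousLinearMap.det, LinearMap.det_restrictScalars, Algebra.norm_complex_eq, Complex.normSq_eq_norm_sq]

lemma setLIntegral_reProdIm {A B : Set ℝ} {g : ℂ → ℝ≥0∞} (hg : Measurable g) :
    ∫⁻ z in A ×ℂ B, g z = ∫⁻ x in A, ∫⁻ y in B, g (x + y * I) := by
  have h := Complex.volume_preserving_equiv_real_prod.symm.setLIntegral_comp_emb
    Complex.measurableEquivRealProd.symm.measurableEmbedding g (A ×ˢ B)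
  have hi : Complex.measurableEquivRealProd.symm '' (A ×ˢ B) = A ×ℂ B := by
    ext z
    constructor
    · rintro ⟨p, hp, rfl⟩
      exact hp
    · intro hz
      exact ⟨(z.re, z.im), hz, rfl⟩
  rw [← hi, ← h, Measure.volume_eq_prod, setLIntegral_prod]
  · simp [Complex.measurableEquivRealProd, Complex.equivRealProdCLM_symm_apply]
  · exact (hg.comp (MeasurableEquiv.measurable _)).aemeasurable

lemma setLIntegral_reProdIm_symm {A B : Set ℝ} {g : ℂ → ℝ≥0∞} (hg : Measurable g) :
    ∫⁻ z in A ×ℂ B, g z = ∫⁻ y in B, ∫⁻ x in A, g (x + y * I) := by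
  rw [setLIntegral_reProdIm hg]
  have hm : Measurable (fun p : ℝ × ℝ => g (p.1 + p.2 * I)) := by fun_prop
  rw [lintegral_lintegral_swap hm.aemeasurable]


lemma isOpen_reProdIm {A B : Set ℝ} (hA : IsOpen A) (hB : IsOpen B) : IsOpen (A ×ℂ B) :=
  (hA.preimage continuous_re).inter (hB.preimage continuous_im)

lemma integrableOn_of_lintegral_sq_lt_top {s : Set ℝ} (hs : volume s < ⊤) {g : ℝ → ℂ}
    (hg : Measurable g) (h : ∫⁻ x in s, ‖g x‖ₑ ^ 2 < ⊤) : IntegrableOn g s := by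
  have : IsFiniteMeasure (volume.restrict s) := ⟨by simpa using hs⟩
  have h2 : MemLp g 2 (volume.restrict s) := by
    refine ⟨hg.aestronglyMeasurable, ?_⟩
    rw [eLpNorm_lt_top_iff_lintegral_rpow_enorm_lt_top two_ne_zero ENNReal.ofNat_ne_top]
    simpa using h
  exact h2.integrable one_le_two

lemma hasDerivAt_horizontal {E : ℂ → ℂ} {x y : ℝ} (h : DifferentiableAt ℂ E (x + y * I)) :
    HasDerivAt (fun t : ℝ => E (t + y * I)) (deriv E (x + y * I)) x := by
  have h1 : HasDerivAt (fun t : ℝ => (t : ℂ) + y * I) 1 x := 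
    (Complex.ofRealCLM.hasDerivAt (x := x)).add_const _
  exact (h.hasDerivAt.comp_of_eq x h1 rfl).congr_deriv (by simp)

lemma hasDerivAt_vertical {E : ℂ → ℂ} {x y : ℝ} (h : DifferentiableAt ℂ E (x + y * I)) :
    HasDerivAt (fun t : ℝ => E (x + t * I)) (deriv E (x + y * I) * I) y := by
  have h1 : HasDerivAt (fun t : ℝ => (x : ℂ) + t * I) (1 * I) y := 
    ((Complex.ofRealCLM.hasDerivAt (x := y)).mul_const I).const_add _
  exact (h.hasDerivAt.comp_of_eq y h1 rfl).congr_deriv (by simp)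

/-- Horizontal limits of a bounded univalent function on a half strip. -/
lemma ae_exists_tendsto_horizontal {α β C : ℝ} {E : ℂ → ℂ}
    (hd : DifferentiableOn ℂ E (Iio 0 ×ℂ Ioo α β)) (hi : InjOn E (Iio 0 ×ℂ Ioo α β))
    (hb : ∀ z ∈ Iio 0 ×ℂ Ioo α β, ‖E z‖ ≤ C) :
    ∀ᵐ y : ℝ ∂volume.restrict (Ioo α β),
      ∃ l, Tendsto (fun x : ℝ => E (x + y * I)) (𝓝[<] 0) (𝓝 l) := by
  have hV := isOpen_reProdIm (isOpen_Iio (a := (0 : ℝ))) (isOpen_Ioo (a := α) (b := β))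
  have hmeas : Measurable fun z => ‖deriv E z‖ₑ ^ 2 := (measurable_deriv E).enorm.pow_const 2
  have hfin : ∫⁻ y in Ioo α β, ∫⁻ x in Ioo (-1 : ℝ) 0, ‖deriv E (x + y * I)‖ₑ ^ 2 < ⊤ := by
    rw [← setLIntegral_reProdIm_symm hmeas]
    refine (lintegral_mono_set ?_).trans_lt (lintegral_enorm_deriv_sq_lt_top hV hd hi hb)
    exact fun z hz => ⟨hz.1.2, hz.2⟩
  have hm2 : Measurable fun y : ℝ => ∫⁻ x in Ioo (-1 : ℝ) 0, ‖deriv E (x + y * I)‖ₑ ^ 2 := by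
    have : Measurable (fun p : ℝ × ℝ => ‖deriv E (p.2 + p.1 * I)‖ₑ ^ 2) :=
      hmeas.comp (by fun_prop)
    exact this.lintegral_prod_right'
  filter_upwards [ae_lt_top hm2 hfin.ne, ae_restrict_mem measurableSet_Ioo] with y hy hyB
  have hint : IntegrableOn (fun x : ℝ => deriv E (x + y * I)) (Ioo (-1) 0) :=
    integrableOn_of_lintegral_sq_lt_top (by simp) ((measurable_deriv E).comp (by fun_prop)) hy
  have hint2 : IntegrableOn (fun x : ℝ => deriv E (x + y * I)) (uIcc (-1 / 2) 0) := by
    rw [uIcc_of_le (by norm_num), integrableOn_Icc_iff_integrableOn_Ioo]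
    exact hint.mono_set (Ioo_subset_Ioo (by norm_num) le_rfl)
  have hcont := intervalIntegral.continuousOn_primitive_interval hint2
  refine ⟨E ((-1 / 2 : ℝ) + y * I) + ∫ t in (-1 / 2)..0, deriv E (t + y * I), ?_⟩
  have h0 := (hcont 0 right_mem_uIcc).tendsto
  have h1 : Tendsto (fun x => ∫ t in (-1 / 2 : ℝ)..x, deriv E (t + y * I)) (𝓝[<] 0)
      (𝓝 (∫ t in (-1 / 2 : ℝ)..0, deriv E (t + y * I))) := by
    refine h0.mono_left ?_
    rw [← nhdsWithin_Ico_eq_nhdsLT (show (-1 / 2 : ℝ) < 0 by norm_num), uIcc_of_le (by norm_num)]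
    exact nhdsWithin_mono _ Ico_subset_Icc_self
  refine (h1.const_add _).congr' ?_
  have hmem : Ioo (-1 / 2 : ℝ) 0 ∈ 𝓝[<] (0 : ℝ) := Ioo_mem_nhdsLT (by norm_num)
  filter_upwards [hmem] with x hx
  have hsub : uIcc (-1 / 2) x ⊆ Ioo (-1) 0 := by
    rw [uIcc_of_le hx.1.le]
    exact fun t ht => ⟨by linarith [ht.1], by linarith [ht.2, hx.2]⟩
  rw [intervalIntegral.integral_eq_sub_of_hasDerivAt
    (f := fun t : ℝ => E (t + y * I)) (f' := fun t : ℝ => deriv E (t + y * I))]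
  · simp
  · intro t ht
    refine hasDerivAt_horizontal (hd.differentiableAt (hV.mem_nhds ?_))
    have := (hsub ht).2
    exact ⟨by simpa using this, by simpa using hyB⟩
  · rw [intervalIntegrable_iff]
    exact hint.mono_set (uIoc_subset_uIcc.trans hsub)

lemma norm_exp_add_mul_I (x y : ℝ) : ‖exp (x + y * I)‖ = Real.exp x := by
  rw [Complex.norm_exp]; simp

/-- A bounded holomorphic function with zero radial limits along an arc vanishes. -/
lemma eq_zero_of_ae_tendsto_zero {α β : ℝ} (hαβ : α < β) {G : ℂ → ℂ}
    (hd : DifferentiableOn ℂ G (ball 0 1)) (hb : ∀ z ∈ ball (0 : ℂ) 1, ‖G z‖ ≤ 1)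
    (h : ∀ᵐ y : ℝ, y ∈ Ioo α β → Tendsto (fun x : ℝ => G (exp (x + y * I))) (𝓝[<] 0) (𝓝 0)) :
    G 0 = 0 := by
  set δ : ℝ := (β - α) / 2 with hδ
  have hδ0 : 0 < δ := by rw [hδ]; linarith
  obtain ⟨N, hN⟩ := exists_nat_gt (2 * Real.pi / δ + 1)
  set P : ℂ → ℂ := fun z => ∏ j ∈ Finset.range N, G (exp (((δ * j : ℝ) : ℂ) * I) * z) with hP
  have hrot : ∀ j : ℕ, ∀ z ∈ ball (0 : ℂ) 1, exp (((δ * j : ℝ) : ℂ) * I) * z ∈ ball (0 : ℂ) 1 := by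
    intro j z hz
    rw [mem_ball_zero_iff] at hz ⊢
    rwa [norm_mul, Complex.norm_exp_ofReal_mul_I, one_mul]
  have hPd : DifferentiableOn ℂ P (ball 0 1) := by
    refine DifferentiableOn.fun_finsetProd fun j _ => ?_
    exact hd.comp (by fun_prop) (hrot j)
  have hPb : ∀ z ∈ ball (0 : ℂ) 1, ‖P z‖ ≤ 1 := by
    intro z hz
    rw [hP, norm_prod]
    exact Finset.prod_le_one (fun _ _ => norm_nonneg _) fun j _ => hb _ (hrot j z hz)
  have hexp : ∀ x : ℝ, x < 0 → ∀ y : ℝ, exp (x + y * I) ∈ ball (0 : ℂ) 1 := by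
    intro x hx y
    rw [mem_ball_zero_iff, norm_exp_add_mul_I]
    exact Real.exp_lt_one_iff.mpr hx
  have hPae : ∀ᵐ y : ℝ, y ∈ uIoc (α - 2 * Real.pi) (α - 2 * Real.pi + 2 * Real.pi) →
      Tendsto (fun x : ℝ => P (exp (x + y * I))) (𝓝[<] 0) (𝓝 0) := by
    have hall : ∀ᵐ y : ℝ, ∀ j : ℕ, y + δ * j ∈ Ioo α β →
        Tendsto (fun x : ℝ => G (exp (x + (y + δ * j : ℝ) * I))) (𝓝[<] 0) (𝓝 0) :=
      ae_all_iff.mpr fun j =>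
        (measurePreserving_add_right volume (δ * j)).quasiMeasurePreserving.ae h
    filter_upwards [hall] with y hy hy2
    rw [uIoc_of_le (by linarith [Real.pi_pos]), sub_add_cancel] at hy2
    set j : ℕ := ⌊(α - y) / δ⌋₊ + 1 with hj
    have hnn : 0 ≤ (α - y) / δ := div_nonneg (by linarith [hy2.2]) hδ0.le
    have h1 : (j : ℝ) ≤ (α - y) / δ + 1 := by
      rw [hj]; push_cast; linarith [Nat.floor_le hnn]
    have h2 : (α - y) / δ < j := by
      rw [hj]; push_cast; exact Nat.lt_floor_add_one _
    have h3 : α - y < δ * j := by rw [div_lt_iff₀ hδ0] at h2; linarith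
    have h4 : δ * j ≤ α - y + δ := by
      have := mul_le_mul_of_nonneg_left h1 hδ0.le
      rwa [mul_add, mul_one, mul_div_cancel₀ _ hδ0.ne'] at this
    have hjN : j < N := by
      have h5 : (α - y) / δ ≤ 2 * Real.pi / δ := by
        gcongr; linarith [hy2.1]
      exact_mod_cast (h1.trans (by linarith)).trans_lt hN
    have ht := hy j ⟨by linarith, by linarith⟩
    rw [tendsto_zero_iff_norm_tendsto_zero] at ht ⊢
    refine tendsto_of_tendsto_of_tendsto_of_le_of_le' tendsto_const_nhds ht
      (Eventually.of_forall fun _ => norm_nonneg _) ?_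
    filter_upwards [self_mem_nhdsWithin] with x hx
    have hx' := hexp x hx y
    rw [hP, norm_prod, ← Finset.mul_prod_erase _ _ (Finset.mem_range.mpr hjN)]
    have heq : exp (((δ * j : ℝ) : ℂ) * I) * exp (x + y * I) = exp (x + (y + δ * j : ℝ) * I) := by
      rw [← Complex.exp_add]; congr 1; push_cast; ring
    rw [heq]
    refine mul_le_of_le_one_right (norm_nonneg _) ?_
    exact Finset.prod_le_one (fun _ _ => norm_nonneg _) fun i _ => hb _ (hrot i _ hx')
  have hmean : ∀ x : ℝ, x < 0 → P 0 = (2 * Real.pi)⁻¹ •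
      ∫ y in (α - 2 * Real.pi)..(α - 2 * Real.pi + 2 * Real.pi), P (exp (x + y * I)) := by
    intro x hx
    have hcl : closedBall (0 : ℂ) |Real.exp x| ⊆ ball 0 1 := by
      rw [abs_of_pos (Real.exp_pos x)]
      exact closedBall_subset_ball (Real.exp_lt_one_iff.mpr hx)
    have hc : DiffContOnCl ℂ P (ball 0 |Real.exp x|) := by
      refine DifferentiableOn.diffContOnCl (hPd.mono ?_)
      exact closure_ball_subset_closedBall.trans hcl
    rw [← hc.circleAverage, Real.circleAverage_def]
    congr 1
    have hcm : ∀ y : ℝ, P (circleMap 0 (Real.exp x) y) = P (exp (x + y * I)) := by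
      intro y
      rw [circleMap_zero, Complex.exp_add, Complex.ofReal_exp]
    simp_rw [← hcm]
    have hper : Function.Periodic (fun y => P (circleMap 0 (Real.exp x) y)) (2 * Real.pi) :=
      (periodic_circleMap 0 (Real.exp x)).comp P
    rw [hper.intervalIntegral_add_eq (α - 2 * Real.pi) 0, zero_add]
  have hlim : Tendsto (fun x : ℝ => ∫ y in (α - 2 * Real.pi)..(α - 2 * Real.pi + 2 * Real.pi),
      P (exp (x + y * I))) (𝓝[<] 0)
      (𝓝 (∫ y in (α - 2 * Real.pi)..(α - 2 * Real.pi + 2 * Real.pi), 0)) := by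
    refine intervalIntegral.tendsto_integral_filter_of_dominated_convergence (fun _ => 1) ?_ ?_ ?_
      hPae
    · filter_upwards [self_mem_nhdsWithin] with x hx
      refine Continuous.aestronglyMeasurable ?_
      exact hPd.continuousOn.comp_continuous (by fun_prop) (hexp x hx)
    · filter_upwards [self_mem_nhdsWithin] with x hx
      exact Eventually.of_forall fun y _ => hPb _ (hexp x hx y)
    · exact intervalIntegrable_const
  have hP0 : P 0 = 0 := by
    have h1 := hlim.const_smul (2 * Real.pi)⁻¹
    rw [intervalIntegral.integral_zero, smul_zero] at h1
    refine tendsto_nhds_unique (tendsto_const_nhds.congr' ?_) h1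
    filter_upwards [self_mem_nhdsWithin] with x hx
    exact hmean x hx
  rw [hP] at hP0
  obtain ⟨j, -, hj⟩ := Finset.prod_eq_zero_iff.mp hP0
  simpa using hj

lemma eq_of_exp_eq_exp {x y : ℂ} (h : exp x = exp y) (hlt : |x.im - y.im| < 2 * Real.pi) :
    x = y := by
  obtain ⟨n, hn⟩ := Complex.exp_eq_exp_iff_exists_int.mp h
  have him : x.im - y.im = n * (2 * Real.pi) := by
    rw [hn]; simp
  rw [him, abs_mul, abs_of_pos Real.two_pi_pos] at hlt
  have h1 : |(n : ℝ)| < 1 := by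
    by_contra! hc
    nlinarith [Real.two_pi_pos]
  have h2 : n = 0 := by
    rw [← Int.cast_abs] at h1
    exact Int.abs_lt_one_iff.mp (by exact_mod_cast h1)
  rw [hn, h2]; simp

/-- Radial limits avoiding a finite set exist for a dense set of directions. -/
theorem DiscParam.exists_radial_limit {U : Set ℂ} {f k : ℂ → ℂ} {a w C : ℂ}
    (h : DiscParam U f k a w C) {α b : ℝ} (hαb : α < b) (F : Finset ℂ) (hF : ∀ p ∈ F, p ∉ U) :
    ∃ θ ∈ Ioo α b, ∃ q ∉ F, Tendsto (fun x : ℝ => f (exp (x + θ * I))) (𝓝[<] 0) (𝓝 q) := by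
  by_contra! hno
  set β := min b (α + 2 * Real.pi) with hβ
  have hαβ : α < β := lt_min hαb (by linarith [Real.pi_pos])
  have hexp : ∀ z : ℂ, z.re < 0 → exp z ∈ ball (0 : ℂ) 1 := by
    intro z hz
    rw [mem_ball_zero_iff, Complex.norm_exp]
    exact Real.exp_lt_one_iff.mpr hz
  have hlim := ae_exists_tendsto_horizontal (α := α) (β := β) (C := ‖C‖) (E := fun z => k (exp z))
    (h.diff.comp (by fun_prop) fun z hz => hexp z hz.1) (by
      intro x hx y hy hxy
      refine eq_of_exp_eq_exp (h.inj (hexp x hx.1) (hexp y hy.1) hxy) ?_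
      have h1 := hx.2
      have h2 := hy.2
      have h3 : β ≤ α + 2 * Real.pi := min_le_right _ _
      rw [mem_preimage, mem_Ioo] at h1 h2
      rw [abs_lt]
      constructor <;> linarith) fun z hz => h.bound _ (hexp z hz.1)
  set H : ℂ → ℂ := fun κ => κ * ∏ p ∈ F, (κ ^ 2 * (a - p) + (1 + w * κ) ^ 2) with hH
  have hHd : Differentiable ℂ H := by
    refine differentiable_id.mul (Differentiable.fun_finsetProd fun p _ => by fun_prop)
  obtain ⟨M, hM⟩ := (isCompact_closedBall (0 : ℂ) ‖C‖).exists_bound_of_continuousOn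
    hHd.continuous.continuousOn
  have hM1 : 0 < max M 1 := lt_max_of_lt_right one_pos
  set G : ℂ → ℂ := fun z => H (k z) / (max M 1 : ℝ) with hG
  have hG0 : G 0 = 0 := by
    refine eq_zero_of_ae_tendsto_zero hαβ ?_ ?_ ?_
    · exact (hHd.comp_differentiableOn h.diff).div_const _
    · intro z hz
      rw [hG, norm_div, Complex.norm_real, Real.norm_eq_abs, abs_of_pos hM1, div_le_one hM1]
      exact (hM _ (mem_closedBall_zero_iff.mpr (h.bound z hz))).trans (le_max_left _ _)
    · rw [ae_restrict_iff' measurableSet_Ioo] at hlim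
      filter_upwards [hlim] with y hy hyB
      obtain ⟨κ, hκ⟩ := hy hyB
      have hHκ : Tendsto (fun x : ℝ => G (exp (x + y * I))) (𝓝[<] 0) (𝓝 (H κ / (max M 1 : ℝ))) :=
        ((hHd.continuous.tendsto κ).comp hκ).div_const _
      suffices H κ = 0 by rwa [this, zero_div] at hHκ
      by_contra hne
      have hκ0 : κ ≠ 0 := left_ne_zero_of_mul hne
      have hprod := right_ne_zero_of_mul hne
      rw [Finset.prod_ne_zero_iff] at hprod
      refine hno y ⟨hyB.1, hyB.2.trans_le (min_le_left _ _)⟩ (a + (1 / κ + w) ^ 2) ?_ ?_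
      · intro hq
        refine hprod _ hq ?_
        field_simp
        ring
      · have h1 : Tendsto (fun x : ℝ => a + (1 / k (exp (x + y * I)) + w) ^ 2) (𝓝[<] 0)
            (𝓝 (a + (1 / κ + w) ^ 2)) :=
          (((tendsto_const_nhds.div hκ hκ0).add_const w).pow 2).const_add a
        refine h1.congr' ?_
        filter_upwards [self_mem_nhdsWithin] with x hx
        exact (h.eq _ (hexp _ (by simpa using hx))).symm
  have h00 : (0 : ℂ) ∈ ball (0 : ℂ) 1 := mem_ball_self one_pos
  have hk0 := h.ne_zero 0 h00
  have hH0 : H (k 0) = 0 := by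
    rcases div_eq_zero_iff.mp hG0 with h1 | h1
    · exact h1
    · exact absurd (Complex.ofReal_eq_zero.mp h1) hM1.ne'
  rcases mul_eq_zero.mp hH0 with h1 | h1
  · exact hk0 h1
  · obtain ⟨p, hp, hp0⟩ := Finset.prod_eq_zero_iff.mp h1
    refine hF p hp ?_
    have h2 : f 0 = p := by
      have h3 : k 0 ^ 2 * (f 0 - p) = 0 := by
        refine Eq.trans ?_ hp0
        rw [h.eq 0 h00]
        field_simp
        ring
      rcases mul_eq_zero.mp h3 with h4 | h4
      · exact absurd h4 (pow_ne_zero 2 hk0)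
      · exact sub_eq_zero.mp h4
    rw [← h2, ← h.image_eq]
    exact mem_image_of_mem f h00

lemma one_add_exp_ne_zero {z : ℂ} (hz : |z.im| < Real.pi / 2) : 1 + exp z ≠ 0 := by
  intro h
  have h1 : (1 + exp z).re = 0 := by rw [h]; rfl
  rw [add_re, one_re, exp_re] at h1
  have := Real.cos_pos_of_mem_Ioo (abs_lt.mp hz)
  have := mul_pos (Real.exp_pos z.re) this
  linarith

/-- The conformal map from the strip `|Im z| < π / 2` to the unit disc sending `-∞` to `ζ`. -/
def stripToDisc (ζ z : ℂ) : ℂ := ζ * ((1 - exp z) / (1 + exp z))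

/-- The inverse of `stripToDisc`. -/
def discToStrip (ζ z : ℂ) : ℂ := log ((ζ - z) / (ζ + z))

/-- The strip `|Im z| < π / 2`. -/
def strip : Set ℂ := univ ×ℂ Ioo (-(Real.pi / 2)) (Real.pi / 2)

lemma mem_strip {z : ℂ} : z ∈ strip ↔ |z.im| < Real.pi / 2 := by
  rw [abs_lt, strip, mem_reProdIm]; simp

lemma isOpen_strip : IsOpen strip := isOpen_reProdIm isOpen_univ isOpen_Ioo

lemma stripToDisc_mem {ζ z : ℂ} (hζ : ‖ζ‖ = 1) (hz : z ∈ strip) :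
    stripToDisc ζ z ∈ ball (0 : ℂ) 1 := by
  rw [mem_strip] at hz
  have h0 := one_add_exp_ne_zero hz
  rw [mem_ball_zero_iff, stripToDisc, norm_mul, hζ, one_mul, norm_div,
    div_lt_one (norm_pos_iff.mpr h0)]
  refine lt_of_pow_lt_pow_left₀ 2 (norm_nonneg _) ?_
  rw [← Complex.normSq_eq_norm_sq, ← Complex.normSq_eq_norm_sq, Complex.normSq_sub,
    Complex.normSq_add]
  have h1 : 0 < (1 * conj (exp z)).re := by
    rw [one_mul, conj_re, exp_re]
    exact mul_pos (Real.exp_pos _) (Real.cos_pos_of_mem_Ioo (abs_lt.mp hz))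
  linarith

lemma differentiableOn_stripToDisc (ζ : ℂ) : DifferentiableOn ℂ (stripToDisc ζ) strip := by
  intro z hz
  have h0 := one_add_exp_ne_zero (mem_strip.mp hz)
  refine DifferentiableAt.differentiableWithinAt ?_
  unfold stripToDisc
  fun_prop (disch := assumption)

lemma stripToDisc_injOn {ζ : ℂ} (hζ : ‖ζ‖ = 1) : InjOn (stripToDisc ζ) strip := by
  intro x hx y hy h
  rw [mem_strip] at hx hy
  have hζ0 : ζ ≠ 0 := by rw [← norm_pos_iff, hζ]; exact one_pos
  have h1 := mul_left_cancel₀ hζ0 h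
  rw [div_eq_div_iff (one_add_exp_ne_zero hx) (one_add_exp_ne_zero hy)] at h1
  refine eq_of_exp_eq_exp (by linear_combination (-1 / 2) * h1) ?_
  rw [abs_lt] at hx hy ⊢
  constructor <;> linarith [Real.pi_pos]

lemma add_ne_zero_of_mem_ball {ζ z : ℂ} (hζ : ‖ζ‖ = 1) (hz : z ∈ ball (0 : ℂ) 1) : ζ + z ≠ 0 := by
  intro h
  rw [mem_ball_zero_iff, ← neg_eq_of_add_eq_zero_right h, norm_neg, hζ] at hz
  exact lt_irrefl _ hz

lemma re_div_pos {ζ z : ℂ} (hζ : ‖ζ‖ = 1) (hz : z ∈ ball (0 : ℂ) 1) :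
    0 < ((ζ - z) / (ζ + z)).re := by
  have h0 := add_ne_zero_of_mem_ball hζ hz
  rw [div_re, ← add_div]
  refine div_pos ?_ (normSq_pos.mpr h0)
  have h1 : ‖ζ‖ ^ 2 - ‖z‖ ^ 2 > 0 := by
    rw [mem_ball_zero_iff] at hz
    rw [hζ]; nlinarith [norm_nonneg z]
  rw [← normSq_eq_norm_sq, ← normSq_eq_norm_sq, normSq_apply, normSq_apply] at h1
  simp only [sub_re, add_re, sub_im, add_im]
  linarith

lemma discToStrip_mem {ζ z : ℂ} (hζ : ‖ζ‖ = 1) (hz : z ∈ ball (0 : ℂ) 1) :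
    discToStrip ζ z ∈ strip := by
  rw [mem_strip, discToStrip, log_im, abs_arg_lt_pi_div_two_iff]
  exact Or.inl (re_div_pos hζ hz)

lemma stripToDisc_discToStrip {ζ z : ℂ} (hζ : ‖ζ‖ = 1) (hz : z ∈ ball (0 : ℂ) 1) :
    stripToDisc ζ (discToStrip ζ z) = z := by
  have h0 := add_ne_zero_of_mem_ball hζ hz
  have hζ0 : ζ ≠ 0 := by rw [← norm_pos_iff, hζ]; exact one_pos
  have h1 : (ζ - z) / (ζ + z) ≠ 0 := fun h => by
    have := re_div_pos hζ hz
    rw [h] at this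
    exact lt_irrefl _ this
  rw [stripToDisc, discToStrip, exp_log h1]
  field_simp
  ring_nf
  field_simp

lemma continuousOn_discToStrip {ζ : ℂ} (hζ : ‖ζ‖ = 1) :
    ContinuousOn (discToStrip ζ) (ball 0 1) := by
  refine ContinuousOn.clog ?_ fun z hz => Or.inl (re_div_pos hζ hz)
  exact (by fun_prop : ContinuousOn _ _).div (by fun_prop) fun z hz => add_ne_zero_of_mem_ball hζ hz

lemma tendsto_re_discToStrip {ζ : ℂ} (hζ : ‖ζ‖ = 1) :
    Tendsto (fun z => (discToStrip ζ z).re) (𝓝[ball 0 1] ζ) atBot := by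
  have hζ0 : ζ ≠ 0 := by rw [← norm_pos_iff, hζ]; exact one_pos
  have h1 : Tendsto (fun z => ‖(ζ - z) / (ζ + z)‖) (𝓝[ball 0 1] ζ) (𝓝[>] 0) := by
    rw [tendsto_nhdsWithin_iff]
    constructor
    · have : ContinuousAt (fun z => ‖(ζ - z) / (ζ + z)‖) ζ := by
        have : ζ + ζ ≠ 0 := by rw [← two_mul]; exact mul_ne_zero two_ne_zero hζ0
        fun_prop (disch := assumption)
      have h2 := this.tendsto
      simp only [sub_self, zero_div, norm_zero] at h2
      exact h2.mono_left nhdsWithin_le_nhds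
    · filter_upwards [self_mem_nhdsWithin] with z hz
      rw [mem_Ioi, norm_pos_iff]
      intro h
      have := re_div_pos hζ hz
      rw [h] at this
      exact lt_irrefl _ this
  refine (Real.tendsto_log_nhdsGT_zero.comp h1).congr fun z => ?_
  rw [discToStrip, log_re]
  rfl

lemma enorm_sub_le_lintegral_deriv {L : ℂ → ℂ} (hd : DifferentiableOn ℂ L strip) {x u v : ℝ}
    (hu : u ∈ Ioo (-(Real.pi / 2)) (Real.pi / 2)) (hv : v ∈ Ioo (-(Real.pi / 2)) (Real.pi / 2))
    (huv : u ≤ v) :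
    ‖L (x + v * I) - L (x + u * I)‖ₑ ≤
      ∫⁻ y in Ioo (-(Real.pi / 2)) (Real.pi / 2), ‖deriv L (x + y * I)‖ₑ := by
  have hsub : uIcc u v ⊆ Ioo (-(Real.pi / 2)) (Real.pi / 2) :=
    (ordConnected_Ioo (a := -(Real.pi / 2)) (b := Real.pi / 2)).uIcc_subset hu hv
  have hmem : ∀ y ∈ uIcc u v, (x + y * I : ℂ) ∈ strip := fun y hy => by
    have := hsub hy
    rw [strip, mem_reProdIm]
    simpa using this
  have hcont : ContinuousOn (fun y : ℝ => deriv L (x + y * I) * I) (uIcc u v) := by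
    refine ContinuousOn.mul ?_ continuousOn_const
    exact (hd.deriv isOpen_strip).continuousOn.comp (by fun_prop) hmem
  have h := intervalIntegral.integral_eq_sub_of_hasDerivAt (f := fun t : ℝ => L (x + t * I))
    (fun y hy => hasDerivAt_vertical (hd.differentiableAt (isOpen_strip.mem_nhds (hmem y hy))))
    hcont.intervalIntegrable
  rw [← h, intervalIntegral.integral_of_le huv]
  refine (enorm_integral_le_lintegral_enorm _).trans ?_
  simp only [enorm_mul]
  have hI : ‖I‖ₑ = 1 := by rw [← ofReal_norm]; simp
  simp only [hI, mul_one]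
  exact lintegral_mono_set (Ioc_subset_Icc_self.trans (uIcc_of_le huv ▸ hsub))

lemma le_add_sq_div {ε u : ℝ≥0∞} (h0 : ε ≠ 0) (ht : ε ≠ ⊤) : u ≤ ε + u ^ 2 / ε := by
  rcases le_total u ε with h | h
  · exact h.trans le_self_add
  · refine le_add_left ?_
    rw [ENNReal.le_div_iff_mul_le (Or.inl h0) (Or.inl ht), pow_two]
    gcongr

/-- Two curves going to the left end of the strip: a bounded univalent function cannot separate
them. -/
lemma not_separated_of_univalent {L : ℂ → ℂ} (hd : DifferentiableOn ℂ L strip)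
    (hi : InjOn L strip) {C : ℝ} (hb : ∀ z ∈ strip, ‖L z‖ ≤ C) {c x₀ : ℝ} (hc : 0 < c)
    (h : ∀ x < x₀, ∃ u ∈ Ioo (-(Real.pi / 2)) (Real.pi / 2),
      ∃ v ∈ Ioo (-(Real.pi / 2)) (Real.pi / 2), c ≤ ‖L (x + v * I) - L (x + u * I)‖) : False := by
  have hfin := lintegral_enorm_deriv_sq_lt_top isOpen_strip hd hi hb
  rw [strip, setLIntegral_reProdIm ((measurable_deriv L).enorm.pow_const 2)] at hfin
  set ε : ℝ := c / (2 * Real.pi) with hε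
  have hε0 : 0 < ε := by positivity
  have hE0 : ENNReal.ofReal ε ≠ 0 := by simpa using hε0
  have hbound : ∀ x < x₀, ENNReal.ofReal (ε * (c / 2)) ≤
      ∫⁻ y in Ioo (-(Real.pi / 2)) (Real.pi / 2), ‖deriv L (x + y * I)‖ₑ ^ 2 := by
    intro x hx
    set A := ∫⁻ y in Ioo (-(Real.pi / 2)) (Real.pi / 2), ‖deriv L (x + y * I)‖ₑ ^ 2 with hA
    have h1 : ENNReal.ofReal c ≤
        ∫⁻ y in Ioo (-(Real.pi / 2)) (Real.pi / 2), ‖deriv L (x + y * I)‖ₑ := by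
      obtain ⟨u, hu, v, hv, huv⟩ := h x hx
      rcases le_total u v with hle | hle
      · refine le_trans ?_ (enorm_sub_le_lintegral_deriv hd hu hv hle)
        rw [← ofReal_norm]
        exact ENNReal.ofReal_le_ofReal huv
      · refine le_trans ?_ (enorm_sub_le_lintegral_deriv hd hv hu hle)
        rw [← ofReal_norm, norm_sub_rev]
        exact ENNReal.ofReal_le_ofReal huv
    have h2 : (∫⁻ y in Ioo (-(Real.pi / 2)) (Real.pi / 2), ‖deriv L (x + y * I)‖ₑ) ≤
        ENNReal.ofReal (c / 2) + A / ENNReal.ofReal ε := by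
      refine (lintegral_mono fun y => le_add_sq_div hE0 ENNReal.ofReal_ne_top).trans ?_
      rw [lintegral_add_left measurable_const, setLIntegral_const, Real.volume_Ioo,
        ← ENNReal.ofReal_mul hε0.le]
      simp only [div_eq_mul_inv _ (ENNReal.ofReal ε)]
      rw [lintegral_mul_const' _ _ (ENNReal.inv_ne_top.mpr hE0)]
      refine le_of_eq ?_
      congr 2
      rw [hε]; field_simp; ring
    have h3 : ENNReal.ofReal (c / 2) ≤ A / ENNReal.ofReal ε := by
      have h4 := h1.trans h2
      have h5 : ENNReal.ofReal c = ENNReal.ofReal (c / 2) + ENNReal.ofReal (c / 2) := by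
        rw [← ENNReal.ofReal_add (by positivity) (by positivity), add_halves]
      rw [h5] at h4
      exact (ENNReal.add_le_add_iff_left ENNReal.ofReal_ne_top).mp h4
    rw [ENNReal.le_div_iff_mul_le (Or.inl hE0) (Or.inl ENNReal.ofReal_ne_top)] at h3
    rwa [mul_comm, ENNReal.ofReal_mul (by positivity)]
  have htop : (⊤ : ℝ≥0∞) ≤ ∫⁻ x : ℝ in univ, ∫⁻ y in Ioo (-(Real.pi / 2)) (Real.pi / 2),
      ‖deriv L (x + y * I)‖ₑ ^ 2 := by
    calc (⊤ : ℝ≥0∞) = ∫⁻ _ in Iio x₀, ENNReal.ofReal (ε * (c / 2)) := by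
          rw [setLIntegral_const, Real.volume_Iio, ENNReal.mul_top]
          simp; positivity
      _ ≤ ∫⁻ x : ℝ in Iio x₀, ∫⁻ y in Ioo (-(Real.pi / 2)) (Real.pi / 2),
            ‖deriv L (x + y * I)‖ₑ ^ 2 := by
          exact setLIntegral_mono' measurableSet_Iio fun x hx => hbound x hx
      _ ≤ _ := lintegral_mono_set (subset_univ _)
  exact absurd hfin (not_lt.mpr htop)

lemma exists_re_discToStrip_eq {ζ : ℂ} (hζ : ‖ζ‖ = 1) {γ : ℝ → ℂ} (hγ : ContinuousOn γ (Ioo 0 1))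
    (hγb : ∀ t ∈ Ioo (0 : ℝ) 1, γ t ∈ ball (0 : ℂ) 1) (hγt : Tendsto γ (𝓝[>] 0) (𝓝 ζ)) {t₀ : ℝ}
    (h0 : 0 < t₀) (h1 : t₀ < 1) :
    ∃ x₀, ∀ x < x₀, ∃ t ∈ Ioc 0 t₀, (discToStrip ζ (γ t)).re = x := by
  refine ⟨(discToStrip ζ (γ t₀)).re, fun x hx => ?_⟩
  have hin : ∀ᶠ t in 𝓝[>] (0 : ℝ), t ∈ Ioo 0 t₀ := Ioo_mem_nhdsGT h0
  have hlim : Tendsto (fun t => (discToStrip ζ (γ t)).re) (𝓝[>] 0) atBot := by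
    refine (tendsto_re_discToStrip hζ).comp (tendsto_nhdsWithin_iff.mpr ⟨hγt, ?_⟩)
    filter_upwards [hin] with t ht
    exact hγb t ⟨ht.1, ht.2.trans h1⟩
  obtain ⟨s, hs, hsx⟩ := (hin.and (hlim.eventually_le_atBot x)).exists
  have hsub : Icc s t₀ ⊆ Ioo 0 1 := fun t ht => ⟨hs.1.trans_le ht.1, ht.2.trans_lt h1⟩
  have hcont : ContinuousOn (fun t => (discToStrip ζ (γ t)).re) (Icc s t₀) :=
    continuous_re.comp_continuousOn
      ((continuousOn_discToStrip hζ).comp (hγ.mono hsub) fun t ht => hγb t (hsub ht))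
  obtain ⟨t, ht, htx⟩ := intermediate_value_Icc hs.2.le hcont ⟨hsx, hx.le⟩
  exact ⟨t, ⟨hs.1.trans_le ht.1, ht.2⟩, htx⟩

/-- Two curves in the disc landing at the same boundary point whose images land have the same
landing point. -/
theorem DiscParam.unique_landing {U : Set ℂ} {f k : ℂ → ℂ} {a w C : ℂ}
    (h : DiscParam U f k a w C) {ζ p q : ℂ} (hζ : ‖ζ‖ = 1) {γ η : ℝ → ℂ}
    (hγ : ContinuousOn γ (Ioo 0 1)) (hη : ContinuousOn η (Ioo 0 1))
    (hγb : ∀ t ∈ Ioo (0 : ℝ) 1, γ t ∈ ball (0 : ℂ) 1)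
    (hηb : ∀ t ∈ Ioo (0 : ℝ) 1, η t ∈ ball (0 : ℂ) 1)
    (hγt : Tendsto γ (𝓝[>] 0) (𝓝 ζ)) (hηt : Tendsto η (𝓝[>] 0) (𝓝 ζ))
    (hp : Tendsto (fun t => f (γ t)) (𝓝[>] 0) (𝓝 p))
    (hq : Tendsto (fun t => f (η t)) (𝓝[>] 0) (𝓝 q)) : p = q := by
  by_contra hpq
  set d := ‖p - q‖ / 3 with hd
  have hd0 : 0 < d := div_pos (norm_pos_iff.mpr (sub_ne_zero.mpr hpq)) three_pos
  have hev : ∀ᶠ t in 𝓝[>] (0 : ℝ), f (γ t) ∈ ball p d ∧ f (η t) ∈ ball q d :=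
    (hp.eventually (ball_mem_nhds p hd0)).and (hq.eventually (ball_mem_nhds q hd0))
  obtain ⟨t₁, ht₁, hsub⟩ := mem_nhdsGT_iff_exists_Ioc_subset.mp hev
  set t₀ := min t₁ (1 / 2) with ht₀
  have h0 : 0 < t₀ := lt_min ht₁ (by norm_num)
  have h1 : t₀ < 1 := (min_le_right _ _).trans_lt (by norm_num)
  have hle : ∀ t ∈ Ioc 0 t₀, t ∈ Ioo (0 : ℝ) 1 ∧ f (γ t) ∈ ball p d ∧ f (η t) ∈ ball q d :=
    fun t ht => ⟨⟨ht.1, ht.2.trans_lt h1⟩, hsub ⟨ht.1, ht.2.trans (min_le_left _ _)⟩⟩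
  obtain ⟨x₁, hx₁⟩ := exists_re_discToStrip_eq hζ hγ hγb hγt h0 h1
  obtain ⟨x₂, hx₂⟩ := exists_re_discToStrip_eq hζ hη hηb hηt h0 h1
  set L : ℂ → ℂ := fun z => k (stripToDisc ζ z) with hL
  have hLm : MapsTo (stripToDisc ζ) strip (ball 0 1) := fun z hz => stripToDisc_mem hζ hz
  set B := max (‖p - a‖ + d) (‖q - a‖ + d) with hB
  set b := max B 1 with hb
  have hb1 : 1 ≤ b := le_max_right _ _
  have key : ∀ z ∈ ball (0 : ℂ) 1, ∀ r : ℂ, ‖r - a‖ + d ≤ B → f z ∈ ball r d →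
      ‖1 / k z + w‖ ≤ b ∧ ‖1 / k z‖ ≤ b + ‖w‖ := by
    intro z hz r hr hfz
    have e1 : ‖f z - a‖ ≤ B := by
      refine le_trans ?_ hr
      rw [mem_ball, dist_eq_norm] at hfz
      calc ‖f z - a‖ = ‖(f z - r) + (r - a)‖ := by ring_nf
        _ ≤ ‖f z - r‖ + ‖r - a‖ := norm_add_le _ _
        _ ≤ _ := by linarith
    have e2 : ‖1 / k z + w‖ ^ 2 ≤ b := by
      rw [← norm_pow, show (1 / k z + w) ^ 2 = f z - a by rw [h.eq z hz]; ring]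
      exact e1.trans (le_max_left _ _)
    have e3 : ‖1 / k z + w‖ ≤ b := by
      nlinarith [norm_nonneg (1 / k z + w)]
    refine ⟨e3, ?_⟩
    calc ‖1 / k z‖ = ‖(1 / k z + w) - w‖ := by ring_nf
      _ ≤ _ := (norm_sub_le _ _).trans (by linarith)
  set M := (b + ‖w‖) ^ 2 * (b + b) with hM
  have hM0 : 0 < M := by positivity
  refine not_separated_of_univalent (L := L) (c := d / M) (x₀ := min x₁ x₂)
    (h.diff.comp (differentiableOn_stripToDisc ζ) hLm)
    (h.inj.comp (stripToDisc_injOn hζ) hLm) (fun z hz => h.bound _ (hLm hz)) (by positivity) ?_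
  intro x hx
  obtain ⟨s, hs, hsx⟩ := hx₁ x (hx.trans_le (min_le_left _ _))
  obtain ⟨t, ht, htx⟩ := hx₂ x (hx.trans_le (min_le_right _ _))
  obtain ⟨hs1, hs2, -⟩ := hle s hs
  obtain ⟨ht1, -, ht2⟩ := hle t ht
  have hLz : ∀ z ∈ ball (0 : ℂ) 1, (discToStrip ζ z).re = x →
      L (x + (discToStrip ζ z).im * I) = k z := by
    intro z hz hzx
    rw [← hzx, re_add_im]
    simp only [hL]
    rw [stripToDisc_discToStrip hζ hz]
  refine ⟨(discToStrip ζ (γ s)).im, (discToStrip_mem hζ (hγb s hs1)).2,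
    (discToStrip ζ (η t)).im, (discToStrip_mem hζ (hηb t ht1)).2, ?_⟩
  rw [hLz _ (hγb s hs1) hsx, hLz _ (hηb t ht1) htx]
  obtain ⟨a1, a2⟩ := key _ (hγb s hs1) p (le_max_left _ _) hs2
  obtain ⟨b1, b2⟩ := key _ (hηb t ht1) q (le_max_right _ _) ht2
  have hk1 := h.ne_zero _ (hγb s hs1)
  have hk2 := h.ne_zero _ (hηb t ht1)
  have hdist : d ≤ ‖f (γ s) - f (η t)‖ := by
    rw [mem_ball, dist_eq_norm] at hs2 ht2
    have : ‖p - q‖ ≤ ‖f (γ s) - p‖ + ‖f (γ s) - f (η t)‖ + ‖f (η t) - q‖ := by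
      calc ‖p - q‖ = ‖-(f (γ s) - p) + (f (γ s) - f (η t)) + (f (η t) - q)‖ := by ring_nf
        _ ≤ _ := norm_add₃_le.trans (by rw [norm_neg])
    linarith
  have hid : f (γ s) - f (η t) = (k (η t) - k (γ s)) * ((1 / k (γ s)) * (1 / k (η t))) *
      ((1 / k (γ s) + w) + (1 / k (η t) + w)) := by
    rw [h.eq _ (hγb s hs1), h.eq _ (hηb t ht1)]
    field_simp
    ring
  rw [div_le_iff₀ hM0]
  refine hdist.trans ?_
  rw [hid, norm_mul, norm_mul, norm_mul (1 / k (γ s)), mul_assoc]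
  refine mul_le_mul_of_nonneg_left ?_ (norm_nonneg _)
  rw [hM, pow_two]
  gcongr
  exact (norm_add_le _ _).trans (add_le_add a1 b1)

/-! ### Topology of the disc model -/

/-- A parametrization `φ` of `U` by the open unit disc with the boundary behaviour of a Riemann
map. -/
structure DiscModel (φ : ℂ → X) (U : Set X) : Prop where
  contOn : ContinuousOn φ (ball 0 1)
  injOn : InjOn φ (ball 0 1)
  image_eq : φ '' ball 0 1 = U
  isOpen_image : ∀ V, IsOpen V → V ⊆ ball 0 1 → IsOpen (φ '' V)
  accessible : ∀ a b : ℝ, a < b → ∀ F : Finset X, (∀ p ∈ F, p ∉ U) → ∃ θ ∈ Ioo a b, ∃ q ∉ F,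
    Tendsto (fun x : ℝ => φ (exp (x + θ * I))) (𝓝[<] 0) (𝓝 q)
  unique_landing : ∀ ζ : ℂ, ‖ζ‖ = 1 → ∀ p q : X, ∀ γ η : ℝ → ℂ, ContinuousOn γ (Ioo 0 1) →
    ContinuousOn η (Ioo 0 1) → (∀ t ∈ Ioo (0 : ℝ) 1, γ t ∈ ball (0 : ℂ) 1) →
    (∀ t ∈ Ioo (0 : ℝ) 1, η t ∈ ball (0 : ℂ) 1) → Tendsto γ (𝓝[>] 0) (𝓝 ζ) →
    Tendsto η (𝓝[>] 0) (𝓝 ζ) → Tendsto (fun t => φ (γ t)) (𝓝[>] 0) (𝓝 p) →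
    Tendsto (fun t => φ (η t)) (𝓝[>] 0) (𝓝 q) → p = q

lemma exp_mem_ball {z : ℂ} (hz : z.re < 0) : exp z ∈ ball (0 : ℂ) 1 := by
  rw [mem_ball_zero_iff, Complex.norm_exp]
  exact Real.exp_lt_one_iff.mpr hz

lemma exp_add_mul_I_mem_ball {x : ℝ} (hx : x < 0) (θ : ℝ) : exp (x + θ * I) ∈ ball (0 : ℂ) 1 :=
  exp_mem_ball (by simpa using hx)

namespace DiscModel

variable {φ : ℂ → X} {U : Set X} (h : DiscModel φ U)
include h

lemma mem {z : ℂ} (hz : z ∈ ball (0 : ℂ) 1) : φ z ∈ U := h.image_eq ▸ mem_image_of_mem φ hz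

lemma isOpen : IsOpen U := h.image_eq ▸ h.isOpen_image _ isOpen_ball Subset.rfl

lemma tendsto_of_tendsto_image {ι : Type*} {l : Filter ι} {z : ι → ℂ}
    (hz : ∀ᶠ i in l, z i ∈ ball (0 : ℂ) 1) {z₀ : ℂ} (hz₀ : z₀ ∈ ball (0 : ℂ) 1)
    (ht : Tendsto (fun i => φ (z i)) l (𝓝 (φ z₀))) : Tendsto z l (𝓝 z₀) := by
  rw [_root_.tendsto_nhds]
  intro V hV hzV
  have ho := h.isOpen_image _ (hV.inter isOpen_ball) inter_subset_right
  filter_upwards [hz, ht (ho.mem_nhds ⟨z₀, ⟨hzV, hz₀⟩, rfl⟩)] with i hi ⟨y, hy, hyi⟩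
  rw [mem_preimage, ← h.injOn hy.2 hi hyi]
  exact hy.1

lemma notMem_of_tendsto {ι : Type*} {l : Filter ι} [l.NeBot] {z : ι → ℂ}
    (hz : ∀ᶠ i in l, z i ∈ ball (0 : ℂ) 1) {ζ : ℂ} (hζ : ‖ζ‖ = 1) (ht : Tendsto z l (𝓝 ζ)) {q : X}
    (hq : Tendsto (fun i => φ (z i)) l (𝓝 q)) : q ∉ U := by
  rw [← h.image_eq]
  rintro ⟨z₀, hz₀, rfl⟩
  have := tendsto_nhds_unique ht (h.tendsto_of_tendsto_image hz hz₀ hq)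
  rw [mem_ball_zero_iff, ← this, hζ] at hz₀
  exact lt_irrefl _ hz₀

lemma eventually_lt_norm [T2Space X] {ι : Type*} {l : Filter ι} {z : ι → ℂ} {q : X} (hqU : q ∉ U)
    (hq : Tendsto (fun i => φ (z i)) l (𝓝 q)) {r : ℝ} (hr : r < 1) : ∀ᶠ i in l, r < ‖z i‖ := by
  have hsub : closedBall (0 : ℂ) r ⊆ ball 0 1 := closedBall_subset_ball hr
  have hK : IsClosed (φ '' closedBall 0 r) :=
    ((isCompact_closedBall _ _).image_of_continuousOn (h.contOn.mono hsub)).isClosed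
  have hqK : q ∈ (φ '' closedBall 0 r)ᶜ := by
    rintro ⟨z, hz, rfl⟩
    exact hqU (h.mem (hsub hz))
  filter_upwards [hq (hK.isOpen_compl.mem_nhds hqK)] with i hi
  by_contra! hc
  exact hi ⟨z i, mem_closedBall_zero_iff.mpr hc, rfl⟩

lemma radial_notMem {θ : ℝ} {q : X}
    (hq : Tendsto (fun x : ℝ => φ (exp (x + θ * I))) (𝓝[<] 0) (𝓝 q)) : q ∉ U := by
  refine h.notMem_of_tendsto (z := fun x : ℝ => exp (x + θ * I)) (ζ := exp (θ * I)) ?_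
    (norm_exp_ofReal_mul_I θ) ?_ hq
  · filter_upwards [self_mem_nhdsWithin] with x hx
    exact exp_add_mul_I_mem_ball hx θ
  · have : Continuous fun x : ℝ => exp (x + θ * I) := by fun_prop
    have h1 := this.tendsto 0
    rw [ofReal_zero, zero_add] at h1
    exact h1.mono_left nhdsWithin_le_nhds

/-- A curve landing in `X` eventually avoids the rays landing elsewhere. -/
lemma eventually_ne_ray [T2Space X] {ι : Type*} {l : Filter ι} {z : ι → ℂ}
    (hz : ∀ᶠ i in l, z i ∈ ball (0 : ℂ) 1) {p q : X} (hpU : p ∉ U)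
    (hp : Tendsto (fun i => φ (z i)) l (𝓝 p)) {θ : ℝ} (hpq : q ≠ p)
    (hq : Tendsto (fun x : ℝ => φ (exp (x + θ * I))) (𝓝[<] 0) (𝓝 q)) :
    ∀ᶠ i in l, z i ≠ ‖z i‖ * exp (θ * I) := by
  obtain ⟨V, W, hV, hW, hqV, hpW, hVW⟩ := t2_separation hpq
  obtain ⟨x₁, hx₁, hsub⟩ := mem_nhdsLT_iff_exists_Ioo_subset.mp (hq (hV.mem_nhds hqV))
  have hx₁0 : x₁ < 0 := hx₁
  filter_upwards [hz, hp (hW.mem_nhds hpW),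
    h.eventually_lt_norm hpU hp (Real.exp_lt_one_iff.mpr hx₁0)] with i hi hiW hin heq
  have hpos : 0 < ‖z i‖ := (Real.exp_pos _).trans hin
  have hmem : Real.log ‖z i‖ ∈ Ioo x₁ 0 :=
    ⟨(Real.lt_log_iff_exp_lt hpos).mpr hin,
      Real.log_neg hpos (mem_ball_zero_iff.mp hi)⟩
  have h1 := hsub hmem
  rw [mem_preimage, Complex.exp_add, ← ofReal_exp, Real.exp_log hpos, ← heq] at h1
  exact disjoint_left.mp hVW h1 hiW

end DiscModel

/-- Changes sign exactly across the two rays with angles `μ ± ν`. -/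
def sideFun (μ ν : ℝ) (z : ℂ) : ℝ := (z * exp (-μ * I)).re - ‖z‖ * Real.cos ν

lemma continuous_sideFun (μ ν : ℝ) : Continuous (sideFun μ ν) := by
  unfold sideFun; fun_prop

lemma sideFun_polar (μ ν s : ℝ) {r : ℝ} (hr : 0 ≤ r) :
    sideFun μ ν (r * exp (s * I)) = r * (Real.cos (s - μ) - Real.cos ν) := by
  have h1 : (r * exp (s * I)) * exp (-μ * I) = r * exp ((s - μ : ℝ) * I) := by
    rw [mul_assoc, ← Complex.exp_add]; congr 2; push_cast; ring
  rw [sideFun, h1, norm_mul, norm_exp_ofReal_mul_I, norm_real, Real.norm_of_nonneg hr,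
    re_ofReal_mul, exp_ofReal_mul_I_re]
  ring

lemma eq_ray_of_sideFun_eq_zero {μ ν : ℝ} {z : ℂ} (hz : z ≠ 0) (h : sideFun μ ν z = 0) :
    z = ‖z‖ * exp ((μ + ν : ℝ) * I) ∨ z = ‖z‖ * exp ((μ - ν : ℝ) * I) := by
  have hpos : 0 < ‖z‖ := norm_pos_iff.mpr hz
  rw [← norm_mul_exp_arg_mul_I z, sideFun_polar _ _ _ hpos.le] at h
  have h1 : Real.cos (arg z - μ) = Real.cos ν := by
    rcases mul_eq_zero.mp h with h2 | h2
    · exact absurd h2 hpos.ne'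
    · linarith
  obtain ⟨n, hn | hn⟩ := Real.cos_eq_cos_iff.mp h1
  · refine Or.inl ?_
    conv_lhs => rw [← norm_mul_exp_arg_mul_I z]
    congr 1
    rw [Complex.exp_eq_exp_iff_exists_int]
    refine ⟨-n, ?_⟩
    have : arg z = μ + ν - 2 * n * Real.pi := by linarith
    rw [this]; push_cast; ring
  · refine Or.inr ?_
    conv_lhs => rw [← norm_mul_exp_arg_mul_I z]
    congr 1
    rw [Complex.exp_eq_exp_iff_exists_int]
    refine ⟨n, ?_⟩
    have : arg z = μ - ν + 2 * n * Real.pi := by linarith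
    rw [this]; push_cast; ring

namespace DiscModel

variable {φ : ℂ → X} {U : Set X} (h : DiscModel φ U)
include h

lemma not_two_cluster_points [T2Space X] {γ : ℝ → ℂ} (hγ : ContinuousOn γ (Ioo 0 1))
    (hγb : ∀ t ∈ Ioo (0 : ℝ) 1, γ t ∈ ball (0 : ℂ) 1) {p : X} (hpU : p ∉ U)
    (hp : Tendsto (fun t => φ (γ t)) (𝓝[>] 0) (𝓝 p)) {a b : ℝ} (hab : a < b)
    (hba : b < a + 2 * Real.pi) (ha : MapClusterPt (exp (a * I)) (𝓝[>] 0) γ)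
    (hb : MapClusterPt (exp (b * I)) (𝓝[>] 0) γ) : False := by
  have hF : ∀ x ∈ ({p} : Finset X), x ∉ U := by simpa using hpU
  obtain ⟨θ₁, hθ₁, q₁, hq₁, hl₁⟩ := h.accessible a b hab {p} hF
  obtain ⟨θ₂, hθ₂, q₂, hq₂, hl₂⟩ := h.accessible b (a + 2 * Real.pi) hba {p} hF
  rw [Finset.mem_singleton] at hq₁ hq₂
  set μ := (θ₁ + θ₂) / 2 with hμ
  set ν := (θ₂ - θ₁) / 2 with hν
  have hin : ∀ᶠ t in 𝓝[>] (0 : ℝ), t ∈ Ioo (0 : ℝ) 1 := Ioo_mem_nhdsGT one_pos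
  have hzb : ∀ᶠ t in 𝓝[>] (0 : ℝ), γ t ∈ ball (0 : ℂ) 1 := hin.mono hγb
  have hev := (h.eventually_ne_ray hzb hpU hp hq₁ hl₁).and
    ((h.eventually_ne_ray hzb hpU hp hq₂ hl₂).and (h.eventually_lt_norm hpU hp one_pos))
  obtain ⟨t₁, ht₁, hsub⟩ := mem_nhdsGT_iff_exists_Ioo_subset.mp (hin.and hev)
  have hmem : Ioo 0 t₁ ∈ 𝓝[>] (0 : ℝ) := Ioo_mem_nhdsGT ht₁
  have hpi := Real.pi_pos
  have hposb : 0 < sideFun μ ν (exp (b * I)) := by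
    have h1 := sideFun_polar μ ν b zero_le_one
    rw [ofReal_one, one_mul, one_mul] at h1
    rw [h1, sub_pos, ← Real.cos_abs (b - μ)]
    refine Real.cos_lt_cos_of_nonneg_of_le_pi (abs_nonneg _) ?_ ?_
    · linarith [hθ₁.1, hθ₂.2]
    · rw [abs_lt]; constructor <;> linarith [hθ₁.2, hθ₂.1]
  have hnega : sideFun μ ν (exp (a * I)) < 0 := by
    have h1 := sideFun_polar μ ν a zero_le_one
    rw [ofReal_one, one_mul, one_mul] at h1
    rw [h1, sub_neg, ← Real.cos_neg (a - μ), neg_sub]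
    rcases le_total (μ - a) Real.pi with hle | hle
    · exact Real.cos_lt_cos_of_nonneg_of_le_pi (by linarith [hθ₁.2, hθ₂.1]) hle
        (by linarith [hθ₁.1])
    · rw [← Real.cos_two_pi_sub (μ - a)]
      exact Real.cos_lt_cos_of_nonneg_of_le_pi (by linarith [hθ₁.2, hθ₂.1]) (by linarith)
        (by linarith [hθ₂.2])
  have hfa := ha.frequently ((continuous_sideFun μ ν).continuousAt.preimage_mem_nhds
    (Iio_mem_nhds hnega))
  have hfb := hb.frequently ((continuous_sideFun μ ν).continuousAt.preimage_mem_nhds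
    (Ioi_mem_nhds hposb))
  obtain ⟨ta, hta, hta'⟩ := (hfa.and_eventually hmem).exists
  obtain ⟨tb, htb, htb'⟩ := (hfb.and_eventually hmem).exists
  have hcont : ContinuousOn (fun t => sideFun μ ν (γ t)) (Ioo 0 t₁) :=
    (continuous_sideFun μ ν).comp_continuousOn (hγ.mono fun t ht => (hsub ht).1)
  obtain ⟨t, ht, ht0⟩ := isPreconnected_Ioo.intermediate_value hta' htb' hcont
    ⟨le_of_lt hta, le_of_lt htb⟩
  obtain ⟨-, hn1, hn2, hn0⟩ := hsub ht
  rcases eq_ray_of_sideFun_eq_zero (norm_pos_iff.mp hn0) ht0 with h1 | h1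
  · refine hn2 ?_
    rwa [show μ + ν = θ₂ by rw [hμ, hν]; ring] at h1
  · refine hn1 ?_
    rwa [show μ - ν = θ₁ by rw [hμ, hν]; ring] at h1

/-- A curve in the disc whose image lands at a boundary point of `U` lands on the circle. -/
lemma tendsto_of_mapClusterPt [T2Space X] {γ : ℝ → ℂ} (hγ : ContinuousOn γ (Ioo 0 1))
    (hγb : ∀ t ∈ Ioo (0 : ℝ) 1, γ t ∈ ball (0 : ℂ) 1) {p : X} (hpU : p ∉ U)
    (hp : Tendsto (fun t => φ (γ t)) (𝓝[>] 0) (𝓝 p)) {ζ : ℂ}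
    (hζ : MapClusterPt ζ (𝓝[>] 0) γ) : Tendsto γ (𝓝[>] 0) (𝓝 ζ) := by
  have hin : ∀ᶠ t in 𝓝[>] (0 : ℝ), t ∈ Ioo (0 : ℝ) 1 := Ioo_mem_nhdsGT one_pos
  have hzb : ∀ᶠ t in 𝓝[>] (0 : ℝ), γ t ∈ closedBall (0 : ℂ) 1 :=
    hin.mono fun t ht => ball_subset_closedBall (hγb t ht)
  have hnorm : ∀ ξ, MapClusterPt ξ (𝓝[>] 0) γ → ‖ξ‖ = 1 := by
    intro ξ hξ
    refine le_antisymm ?_ (le_of_forall_lt_imp_le_of_dense fun r hr => ?_)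
    · have := isClosed_closedBall.mem_of_mapClusterPt hξ hzb
      exact mem_closedBall_zero_iff.mp this
    · have hcl : IsClosed {z : ℂ | r ≤ ‖z‖} := isClosed_le continuous_const continuous_norm
      exact hcl.mem_of_mapClusterPt hξ ((h.eventually_lt_norm hpU hp hr).mono fun t ht => ht.le)
  refine (isCompact_closedBall (0 : ℂ) 1).tendsto_nhds_of_unique_mapClusterPt hzb
    fun ξ _ hξ => ?_
  by_contra hne
  have hpolar : ∀ z : ℂ, ‖z‖ = 1 → z = exp (arg z * I) := fun z hz => by
    conv_lhs => rw [← norm_mul_exp_arg_mul_I z]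
    rw [hz, ofReal_one, one_mul]
  have e1 := hpolar ξ (hnorm ξ hξ)
  have e2 := hpolar ζ (hnorm ζ hζ)
  have hargne : arg ξ ≠ arg ζ := fun h => hne (by rw [e1, e2, h])
  rw [e1] at hξ
  rw [e2] at hζ
  have := arg_le_pi ξ
  have := arg_le_pi ζ
  have := neg_pi_lt_arg ξ
  have := neg_pi_lt_arg ζ
  rcases lt_or_gt_of_ne hargne with h1 | h1
  · exact h.not_two_cluster_points hγ hγb hpU hp h1 (by linarith) hξ hζ
  · exact h.not_two_cluster_points hγ hγb hpU hp h1 (by linarith) hζ hξ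

end DiscModel

/-! ### Cross-cuts from polar boxes -/

lemma re_ofReal_add_mul_I (x y : ℝ) : (x + y * I : ℂ).re = x := by simp

lemma im_ofReal_add_mul_I (x y : ℝ) : (x + y * I : ℂ).im = y := by simp

/-- The depth of `boxPath`. -/
def boxDepth (t : ℝ) : ℝ := min (3 * t) (min 1 (3 * (1 - t)))

/-- The height of `boxPath`. -/
def boxHeight (t : ℝ) : ℝ := max 0 (min 1 (3 * t - 1))

/-- The path running around three sides of the box `[-s, 0] × [a, b]`. -/
def boxPath (s a b t : ℝ) : ℂ := (-(s * boxDepth t) : ℝ) + (a + (b - a) * boxHeight t : ℝ) * I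

lemma boxPath_re (s a b t : ℝ) : (boxPath s a b t).re = -(s * boxDepth t) := by simp [boxPath]

lemma boxPath_im (s a b t : ℝ) : (boxPath s a b t).im = a + (b - a) * boxHeight t := by
  simp [boxPath]

lemma continuous_boxPath (s a b : ℝ) : Continuous (boxPath s a b) := by
  unfold boxPath boxDepth boxHeight; fun_prop

lemma boxPath_of_le {t : ℝ} (h : t ≤ 1 / 3) (s a b : ℝ) :
    boxPath s a b t = (-(s * (3 * t)) : ℝ) + a * I := by
  have h1 : boxDepth t = 3 * t := min_eq_left (le_min (by linarith) (by linarith))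
  have h2 : boxHeight t = 0 := max_eq_left ((min_le_right _ _).trans (by linarith))
  rw [boxPath, h1, h2, mul_zero, add_zero]

lemma boxPath_of_ge {t : ℝ} (h : 2 / 3 ≤ t) (s a b : ℝ) :
    boxPath s a b t = (-(s * (3 * (1 - t))) : ℝ) + b * I := by
  have h1 : boxDepth t = 3 * (1 - t) := by
    rw [boxDepth, min_eq_right (by linarith : 3 * (1 - t) ≤ 1), min_eq_right (by linarith)]
  have h2 : boxHeight t = 1 := by
    rw [boxHeight, min_eq_left (by linarith), max_eq_right zero_le_one]
  rw [boxPath, h1, h2, mul_one, add_sub_cancel]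

lemma boxPath_of_mid {t : ℝ} (h1 : 1 / 3 ≤ t) (h2 : t ≤ 2 / 3) (s a b : ℝ) :
    boxPath s a b t = (-s : ℝ) + (a + (b - a) * (3 * t - 1) : ℝ) * I := by
  have h3 : boxDepth t = 1 := by
    rw [boxDepth, min_eq_left (by linarith : (1 : ℝ) ≤ 3 * (1 - t)), min_eq_right (by linarith)]
  have h4 : boxHeight t = 3 * t - 1 := by
    rw [boxHeight, min_eq_right (by linarith), max_eq_right (by linarith)]
  rw [boxPath, h3, h4, mul_one]

lemma boxDepth_mem {t : ℝ} (ht : t ∈ Ioo (0 : ℝ) 1) : boxDepth t ∈ Ioc (0 : ℝ) 1 :=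
  ⟨lt_min (by linarith [ht.1]) (lt_min one_pos (by linarith [ht.2])),
    (min_le_right _ _).trans (min_le_left _ _)⟩

lemma boxHeight_mem (t : ℝ) : boxHeight t ∈ Icc (0 : ℝ) 1 :=
  ⟨le_max_left _ _, max_le zero_le_one (min_le_left _ _)⟩

lemma boxPath_injOn {s a b : ℝ} (hs : 0 < s) (hab : a < b) : InjOn (boxPath s a b) (Ioo 0 1) := by
  intro t ht u hu h
  have h1 : boxDepth t = boxDepth u := by
    have := congrArg re h
    rw [boxPath_re, boxPath_re, neg_inj] at this
    exact mul_left_cancel₀ hs.ne' this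
  have h2 : boxHeight t = boxHeight u := by
    have := congrArg im h
    rw [boxPath_im, boxPath_im, add_right_inj] at this
    exact mul_left_cancel₀ (sub_pos.mpr hab).ne' this
  simp only [boxDepth, boxHeight, min_def, max_def] at h1 h2
  split_ifs at h1 h2 <;> linarith

lemma boxPath_image {s a b : ℝ} (hs : 0 < s) (hab : a < b) :
    boxPath s a b '' Ioo 0 1 = (Ico (-s) 0 ×ℂ Icc a b) \ (Ioo (-s) 0 ×ℂ Ioo a b) := by
  have hba : 0 < b - a := sub_pos.mpr hab
  ext w
  simp only [Set.mem_sdiff, mem_reProdIm, mem_Ico, mem_Icc, mem_Ioo]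
  constructor
  · rintro ⟨t, ht, rfl⟩
    obtain ⟨hd0, hd1⟩ := boxDepth_mem ht
    obtain ⟨hh0, hh1⟩ := boxHeight_mem t
    rw [boxPath_re, boxPath_im]
    refine ⟨⟨⟨?_, ?_⟩, ?_, ?_⟩, ?_⟩
    · nlinarith
    · nlinarith
    · nlinarith
    · nlinarith
    · rintro ⟨⟨h1, -⟩, h2, h3⟩
      rcases le_total t (1 / 3) with h | h
      · have := congrArg im (boxPath_of_le h s a b)
        rw [boxPath_im] at this
        simp at this
        rcases this with h6 | h6
        · linarith
        · rw [h6] at h2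
          linarith
      rcases le_total t (2 / 3) with h' | h'
      · have := congrArg re (boxPath_of_mid h h' s a b)
        rw [boxPath_re] at this
        simp at this
        linarith
      · have := congrArg im (boxPath_of_ge h' s a b)
        rw [boxPath_im] at this
        simp at this
        linarith
  · rintro ⟨⟨⟨h1, h2⟩, h3, h4⟩, h5⟩
    by_cases ha : w.im = a
    · refine ⟨-w.re / (3 * s), ⟨by apply div_pos <;> linarith, ?_⟩, ?_⟩
      · rw [div_lt_one (by linarith)]; linarith
      · rw [boxPath_of_le]
        · apply Complex.ext
          · rw [re_ofReal_add_mul_I]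
            field_simp
          · rw [im_ofReal_add_mul_I]
            exact ha.symm
        · rw [div_le_div_iff₀ (by linarith) (by linarith)]; linarith
    by_cases hb : w.im = b
    · have hq : 0 < -w.re / (3 * s) := by apply div_pos <;> linarith
      have hq3 : -w.re / (3 * s) ≤ 1 / 3 := by
        rw [div_le_div_iff₀ (by linarith) (by linarith)]; linarith
      refine ⟨1 - -w.re / (3 * s), ⟨by linarith, by linarith⟩, ?_⟩
      rw [boxPath_of_ge (by linarith)]
      apply Complex.ext
      · rw [re_ofReal_add_mul_I]
        field_simp
        ring
      · rw [im_ofReal_add_mul_I]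
        exact hb.symm
    · have h6 : w.re = -s := by
        by_contra hne
        exact h5 ⟨⟨lt_of_le_of_ne h1 (Ne.symm hne), h2⟩, lt_of_le_of_ne h3 (Ne.symm ha),
          lt_of_le_of_ne h4 hb⟩
      have hq : 0 ≤ (w.im - a) / (b - a) := div_nonneg (by linarith) hba.le
      have hq1 : (w.im - a) / (b - a) ≤ 1 := by rw [div_le_one hba]; linarith
      refine ⟨(1 + (w.im - a) / (b - a)) / 3, ⟨by linarith, by linarith⟩, ?_⟩
      rw [boxPath_of_mid (by linarith) (by linarith)]
      apply Complex.ext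
      · rw [re_ofReal_add_mul_I]
        exact h6.symm
      · rw [im_ofReal_add_mul_I]
        field_simp
        ring

/-- The image of an open box under the exponential. -/
def polarBox (s a b : ℝ) : Set ℂ := exp '' (Ioo (-s) 0 ×ℂ Ioo a b)

/-- The image under the exponential of a box containing three of its sides. -/
def polarHull (s a b : ℝ) : Set ℂ := exp '' (Ico (-s) 0 ×ℂ Icc a b)

/-- The complement of a closed polar box in the disc. -/
def polarExt (s a b : ℝ) : Set ℂ := ball 0 1 \ polarHull s a b

lemma isOpen_exp_image {S : Set ℂ} (hS : IsOpen S) : IsOpen (exp '' S) :=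
  Complex.isOpenMap_exp S hS

lemma isOpen_polarBox (s a b : ℝ) : IsOpen (polarBox s a b) :=
  isOpen_exp_image (isOpen_reProdIm isOpen_Ioo isOpen_Ioo)

lemma isPreconnected_reProdIm {A B : Set ℝ} (hA : IsPreconnected A) (hB : IsPreconnected B) :
    IsPreconnected (A ×ℂ B) := by
  have : A ×ℂ B = (fun p : ℝ × ℝ => (p.1 + p.2 * I : ℂ)) '' (A ×ˢ B) := by
    ext w
    constructor
    · intro hw
      exact ⟨(w.re, w.im), hw, re_add_im w⟩
    · rintro ⟨p, hp, rfl⟩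
      rw [mem_reProdIm]
      simpa using hp
  rw [this]
  exact (hA.prod hB).image _ (by fun_prop)

lemma isPreconnected_polarBox (s a b : ℝ) : IsPreconnected (polarBox s a b) :=
  (isPreconnected_reProdIm isPreconnected_Ioo isPreconnected_Ioo).image _ (by fun_prop)

lemma polarHull_subset_ball (s a b : ℝ) : polarHull s a b ⊆ ball 0 1 := by
  rintro _ ⟨w, hw, rfl⟩
  exact exp_mem_ball hw.1.2

lemma polarBox_subset_polarHull (s a b : ℝ) : polarBox s a b ⊆ polarHull s a b :=
  image_mono fun _ hw => ⟨Ioo_subset_Ico_self hw.1, Ioo_subset_Icc_self hw.2⟩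

lemma exp_injOn_strip {a b : ℝ} (hba : b < a + 2 * Real.pi) : InjOn exp (univ ×ℂ Icc a b) := by
  intro x hx y hy h
  refine eq_of_exp_eq_exp h ?_
  have h1 := hx.2
  have h2 := hy.2
  rw [mem_preimage, mem_Icc] at h1 h2
  rw [abs_lt]
  constructor <;> linarith

lemma polarExt_eq (s a b : ℝ) :
    polarExt s a b = ball 0 (min 1 (Real.exp (-s))) ∪ exp '' (Iio 0 ×ℂ Ioo b (a + 2 * Real.pi)) := by
  ext z
  constructor
  · rintro ⟨hz, hzh⟩
    by_cases hn : ‖z‖ < Real.exp (-s)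
    · exact Or.inl (mem_ball_zero_iff.mpr (lt_min (mem_ball_zero_iff.mp hz) hn))
    · push Not at hn
      have hz0 : z ≠ 0 := norm_pos_iff.mp ((Real.exp_pos _).trans_le hn)
      set y := toIcoMod Real.two_pi_pos a (arg z) with hy
      have hym : y ∈ Ico a (a + 2 * Real.pi) := toIcoMod_mem_Ico _ _ _
      have hexp : exp (Real.log ‖z‖ + y * I) = z := by
        rw [Complex.exp_add, ← ofReal_exp, Real.exp_log (norm_pos_iff.mpr hz0)]
        conv_rhs => rw [← norm_mul_exp_arg_mul_I z]
        congr 1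
        rw [Complex.exp_eq_exp_iff_exists_int]
        refine ⟨-toIcoDiv Real.two_pi_pos a (arg z), ?_⟩
        rw [hy, toIcoMod]
        simp only [zsmul_eq_mul]
        push_cast
        ring
      have hlog : Real.log ‖z‖ < 0 := Real.log_neg (norm_pos_iff.mpr hz0) (mem_ball_zero_iff.mp hz)
      have hlog2 : -s ≤ Real.log ‖z‖ := (Real.le_log_iff_exp_le (norm_pos_iff.mpr hz0)).mpr hn
      refine Or.inr ⟨_, ?_, hexp⟩
      rw [mem_reProdIm]
      simp only [re_ofReal_add_mul_I, im_ofReal_add_mul_I]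
      refine ⟨hlog, ?_, hym.2⟩
      by_contra! hyb
      refine hzh ⟨_, ?_, hexp⟩
      rw [mem_reProdIm]
      simp only [re_ofReal_add_mul_I, im_ofReal_add_mul_I]
      exact ⟨⟨hlog2, hlog⟩, hym.1, hyb⟩
  · rintro (hz | ⟨w, hw, rfl⟩)
    · rw [mem_ball_zero_iff, lt_min_iff] at hz
      refine ⟨mem_ball_zero_iff.mpr hz.1, ?_⟩
      rintro ⟨w, hw, rfl⟩
      rw [Complex.norm_exp, Real.exp_lt_exp] at hz
      exact absurd hw.1.1 (not_le.mpr hz.2)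
    · refine ⟨exp_mem_ball hw.1, ?_⟩
      rintro ⟨v, hv, hvw⟩
      have h1 := hw.2
      have h2 := hv.2
      rw [mem_preimage] at h1 h2
      have h3 : v = w := eq_of_exp_eq_exp hvw (by
        rw [abs_lt]; constructor <;> linarith [h1.1, h1.2, h2.1, h2.2])
      rw [h3] at h2
      exact absurd h2.2 (not_le.mpr h1.1)

lemma isOpen_polarExt (s a b : ℝ) : IsOpen (polarExt s a b) := by
  rw [polarExt_eq]
  exact isOpen_ball.union (isOpen_exp_image (isOpen_reProdIm isOpen_Iio isOpen_Ioo))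

lemma isPreconnected_polarExt {s a b : ℝ} (hba : b < a + 2 * Real.pi) :
    IsPreconnected (polarExt s a b) := by
  rw [polarExt_eq]
  have hmin : 0 < min 1 (Real.exp (-s)) := lt_min one_pos (Real.exp_pos _)
  set c := (b + (a + 2 * Real.pi)) / 2 with hc
  set r := Real.log (min 1 (Real.exp (-s)) / 2) with hr
  have hexp : Real.exp r = min 1 (Real.exp (-s)) / 2 := Real.exp_log (by positivity)
  have hr0 : r < 0 := by
    rw [← Real.exp_lt_one_iff, hexp]
    linarith [min_le_left 1 (Real.exp (-s))]
  refine IsPreconnected.union (exp (r + c * I)) ?_ ?_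
    (convex_ball _ _).isPreconnected
    ((isPreconnected_reProdIm isPreconnected_Iio isPreconnected_Ioo).image _ (by fun_prop))
  · rw [mem_ball_zero_iff, norm_exp_add_mul_I, hexp]
    linarith
  · refine ⟨_, ?_, rfl⟩
    rw [mem_reProdIm]
    simp only [re_ofReal_add_mul_I, im_ofReal_add_mul_I]
    exact ⟨hr0, by rw [hc]; constructor <;> linarith⟩

/-- The exponential image of the three sides of the box. -/
lemma exp_boxPath_image {s a b : ℝ} (hs : 0 < s) (hab : a < b) (hba : b < a + 2 * Real.pi) :
    (fun t => exp (boxPath s a b t)) '' Ioo 0 1 = polarHull s a b \ polarBox s a b := by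
  have : (fun t => exp (boxPath s a b t)) '' Ioo 0 1 = exp '' (boxPath s a b '' Ioo 0 1) := by
    rw [image_image]
  rw [this, boxPath_image hs hab]
  have hsub : Ico (-s) 0 ×ℂ Icc a b ⊆ univ ×ℂ Icc a b := fun w hw => ⟨trivial, hw.2⟩
  have hsub2 : Ioo (-s) 0 ×ℂ Ioo a b ⊆ Ico (-s) 0 ×ℂ Icc a b :=
    fun w hw => ⟨Ioo_subset_Ico_self hw.1, Ioo_subset_Icc_self hw.2⟩
  rw [((exp_injOn_strip hba).mono hsub).image_sdiff_subset hsub2]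
  rfl

lemma connectedComponentIn_of_isOpen_union {D₁ D₂ : Set X} (hd : Disjoint D₁ D₂) (ho₁ : IsOpen D₁)
    (ho₂ : IsOpen D₂) (hp : IsPreconnected D₁) {x : X} (hx : x ∈ D₁) :
    connectedComponentIn (D₁ ∪ D₂) x = D₁ := by
  refine Subset.antisymm ?_ (hp.subset_connectedComponentIn hx subset_union_left)
  exact isPreconnected_connectedComponentIn.subset_left_of_subset_union ho₁ ho₂ hd
    (connectedComponentIn_subset _ _) ⟨x, mem_connectedComponentIn (Or.inl hx), hx⟩

lemma hasTwoComps_of_isOpen {D₁ D₂ : Set X} (hd : Disjoint D₁ D₂) (ho₁ : IsOpen D₁)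
    (ho₂ : IsOpen D₂) (hp₁ : IsPreconnected D₁) (hp₂ : IsPreconnected D₂) (hn₁ : D₁.Nonempty)
    (hn₂ : D₂.Nonempty) : HasTwoComps (D₁ ∪ D₂) D₁ D₂ := by
  have h1 : ∀ x ∈ D₁, connectedComponentIn (D₁ ∪ D₂) x = D₁ := fun x hx =>
    connectedComponentIn_of_isOpen_union hd ho₁ ho₂ hp₁ hx
  have h2 : ∀ x ∈ D₂, connectedComponentIn (D₁ ∪ D₂) x = D₂ := fun x hx => by
    rw [union_comm]; exact connectedComponentIn_of_isOpen_union hd.symm ho₂ ho₁ hp₂ hx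
  obtain ⟨x, hx⟩ := hn₁
  obtain ⟨y, hy⟩ := hn₂
  refine ⟨⟨x, Or.inl hx, (h1 x hx).symm⟩, ⟨y, Or.inr hy, (h2 y hy).symm⟩, ?_, ?_⟩
  · rintro rfl
    exact disjoint_left.mp hd hx hx
  · rintro z (hz | hz)
    · exact Or.inl (h1 z hz)
    · exact Or.inr (h2 z hz)

namespace DiscModel

variable {φ : ℂ → X} {U : Set X} (h : DiscModel φ U)
include h

lemma landing_mem_frontier {D : Set X} (hD : D ⊆ U) {θ : ℝ} {q : X}
    (hq : Tendsto (fun x : ℝ => φ (exp (x + θ * I))) (𝓝[<] 0) (𝓝 q))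
    (hev : ∀ᶠ x : ℝ in 𝓝[<] 0, φ (exp (x + θ * I)) ∈ D) : q ∈ frontier D :=
  ⟨mem_closure_of_tendsto hq hev, fun hi => h.radial_notMem hq (hD (interior_subset hi))⟩

lemma landing_mem_frontier_self {θ : ℝ} {q : X}
    (hq : Tendsto (fun x : ℝ => φ (exp (x + θ * I))) (𝓝[<] 0) (𝓝 q)) : q ∈ frontier U := by
  refine h.landing_mem_frontier Subset.rfl hq ?_
  filter_upwards [self_mem_nhdsWithin] with x hx
  exact h.mem (exp_add_mul_I_mem_ball hx θ)

lemma exists_extension_boxPath [T3Space X] {s a b : ℝ} (hs : 0 < s) {p q : X}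
    (hp : Tendsto (fun x : ℝ => φ (exp (x + a * I))) (𝓝[<] 0) (𝓝 p))
    (hq : Tendsto (fun x : ℝ => φ (exp (x + b * I))) (𝓝[<] 0) (𝓝 q))
    (hbox : ∀ t ∈ Ioo (0 : ℝ) 1, exp (boxPath s a b t) ∈ ball (0 : ℂ) 1) :
    ∃ g : ℝ → X, ContinuousOn g (Icc 0 1) ∧ g 0 = p ∧ g 1 = q ∧
      ∀ t ∈ Ioo (0 : ℝ) 1, g t = φ (exp (boxPath s a b t)) := by
  set G : ℝ → X := fun t => φ (exp (boxPath s a b t)) with hG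
  have hc : ContinuousOn G (Ioo 0 1) := h.contOn.comp
    (Complex.continuous_exp.comp (continuous_boxPath s a b)).continuousOn hbox
  have h0 : Tendsto G (𝓝[>] 0) (𝓝 p) := by
    have h1 : Tendsto (fun t : ℝ => -(s * (3 * t))) (𝓝[>] 0) (𝓝[<] 0) := by
      refine tendsto_nhdsWithin_iff.mpr ⟨?_, ?_⟩
      · have : Continuous fun t : ℝ => -(s * (3 * t)) := by fun_prop
        simpa using (this.tendsto 0).mono_left nhdsWithin_le_nhds
      · filter_upwards [self_mem_nhdsWithin] with t ht
        have : 0 < t := ht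
        simp only [mem_Iio]
        have : 0 < s * (3 * t) := by positivity
        linarith
    refine (hp.comp h1).congr' ?_
    filter_upwards [Ioo_mem_nhdsGT (show (0 : ℝ) < 1 / 3 by norm_num)] with t ht
    simp only [hG, Function.comp_apply]
    rw [boxPath_of_le ht.2.le]
  have h1 : Tendsto G (𝓝[<] 1) (𝓝 q) := by
    have h1 : Tendsto (fun t : ℝ => -(s * (3 * (1 - t)))) (𝓝[<] 1) (𝓝[<] 0) := by
      refine tendsto_nhdsWithin_iff.mpr ⟨?_, ?_⟩
      · have : Continuous fun t : ℝ => -(s * (3 * (1 - t))) := by fun_prop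
        simpa using (this.tendsto 1).mono_left nhdsWithin_le_nhds
      · filter_upwards [self_mem_nhdsWithin] with t ht
        have : t < 1 := ht
        simp only [mem_Iio]
        have : 0 < s * (3 * (1 - t)) := mul_pos hs (by linarith)
        linarith
    refine (hq.comp h1).congr' ?_
    filter_upwards [Ioo_mem_nhdsLT (show (2 / 3 : ℝ) < 1 by norm_num)] with t ht
    simp only [hG, Function.comp_apply]
    rw [boxPath_of_ge ht.1.le]
  refine ⟨extendFrom (Ioo 0 1) G, continuousOn_Icc_extendFrom_Ioo hc h0 h1,
    eq_lim_at_left_extendFrom_Ioo one_pos h0, eq_lim_at_right_extendFrom_Ioo one_pos h1,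
    fun t ht => extendFrom_eq (subset_closure ht) (hc t ht)⟩

lemma isCrossSection_polarBox [T3Space X] {s a b : ℝ} (hs : 0 < s) (hab : a < b)
    (hba : b < a + 2 * Real.pi) {p q : X}
    (hp : Tendsto (fun x : ℝ => φ (exp (x + a * I))) (𝓝[<] 0) (𝓝 p))
    (hq : Tendsto (fun x : ℝ => φ (exp (x + b * I))) (𝓝[<] 0) (𝓝 q)) :
    IsCrossSection U (φ '' polarBox s a b) ∧
      closure (bdIn U (φ '' polarBox s a b)) ⊆
        φ '' (polarHull s a b \ polarBox s a b) ∪ {p, q} := by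
  set L := polarHull s a b \ polarBox s a b with hL
  have hLimg := exp_boxPath_image hs hab hba
  have hLb : L ⊆ ball 0 1 := sdiff_subset.trans (polarHull_subset_ball _ _ _)
  have hBb : polarBox s a b ⊆ ball 0 1 :=
    (polarBox_subset_polarHull _ _ _).trans (polarHull_subset_ball _ _ _)
  have hEb : polarExt s a b ⊆ ball 0 1 := sdiff_subset
  have hbox : ∀ t ∈ Ioo (0 : ℝ) 1, exp (boxPath s a b t) ∈ L := fun t ht => by
    rw [hL, ← hLimg]
    exact mem_image_of_mem _ ht
  obtain ⟨g, hgc, hg0, hg1, hg⟩ :=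
    h.exists_extension_boxPath hs hp hq fun t ht => hLb (hbox t ht)
  have hgim : g '' Ioo 0 1 = φ '' L := by
    rw [hL, ← hLimg, image_image]
    exact image_congr hg
  have hgIcc : g '' Icc 0 1 = φ '' L ∪ {p, q} := by
    rw [← hgim, ← Ioo_union_both zero_le_one, image_union, image_pair, hg0, hg1]
  have hLU : φ '' L ⊆ U := by
    rintro _ ⟨z, hz, rfl⟩
    exact h.mem (hLb hz)
  have hBU : φ '' polarBox s a b ⊆ U := by
    rintro _ ⟨z, hz, rfl⟩
    exact h.mem (hBb hz)
  have hEU : φ '' polarExt s a b ⊆ U := by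
    rintro _ ⟨z, hz, rfl⟩
    exact h.mem (hEb hz)
  have hBo := h.isOpen_image _ (isOpen_polarBox s a b) hBb
  have hEo := h.isOpen_image _ (isOpen_polarExt s a b) hEb
  have hd : Disjoint (φ '' polarBox s a b) (φ '' polarExt s a b) := by
    rw [disjoint_left]
    rintro _ ⟨z, hz, rfl⟩ ⟨w, hw, hwz⟩
    rw [h.injOn (hEb hw) (hBb hz) hwz] at hw
    exact hw.2 (polarBox_subset_polarHull _ _ _ hz)
  have hdiff : U \ φ '' L = φ '' polarBox s a b ∪ φ '' polarExt s a b := by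
    have : ball (0 : ℂ) 1 \ L = polarBox s a b ∪ polarExt s a b := by
      ext z
      have := @hBb z
      have := @polarBox_subset_polarHull s a b z
      simp only [hL, polarExt, Set.mem_sdiff, mem_union]
      tauto
    rw [← image_union, ← this, (h.injOn).image_sdiff_subset hLb, h.image_eq]
  have hcontB : ContinuousOn φ (polarBox s a b) := h.contOn.mono hBb
  have hcontE : ContinuousOn φ (polarExt s a b) := h.contOn.mono hEb
  have hnot : ∀ r, r ∉ U → r ∉ ({p, q} : Set X) → r ∉ g '' Icc 0 1 := by
    intro r hr hr2 hm
    rw [hgIcc] at hm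
    rcases hm with hm | hm
    · exact hr (hLU hm)
    · exact hr2 hm
  classical
  have hF : ∀ x ∈ ({p, q} : Finset X), x ∉ U := by
    intro x hx
    rw [Finset.mem_insert, Finset.mem_singleton] at hx
    rcases hx with rfl | rfl
    · exact h.radial_notMem hp
    · exact h.radial_notMem hq
  obtain ⟨θ₁, hθ₁, q₁, hq₁, hl₁⟩ := h.accessible a b hab {p, q} hF
  obtain ⟨θ₂, hθ₂, q₂, hq₂, hl₂⟩ := h.accessible b (a + 2 * Real.pi) hba {p, q} hF
  have hev₁ : ∀ x ∈ Ioo (-s) 0, exp (x + θ₁ * I) ∈ polarBox s a b := fun x hx =>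
    ⟨_, by rw [mem_reProdIm, re_ofReal_add_mul_I, im_ofReal_add_mul_I]; exact ⟨hx, hθ₁⟩, rfl⟩
  have hev₂ : ∀ x ∈ Iio (0 : ℝ), exp (x + θ₂ * I) ∈ polarExt s a b := fun x hx => by
    rw [polarExt_eq]
    exact Or.inr ⟨_, by
      rw [mem_reProdIm, re_ofReal_add_mul_I, im_ofReal_add_mul_I]; exact ⟨hx, hθ₂⟩, rfl⟩
  have hcs : HasTwoComps (U \ φ '' L) (φ '' polarBox s a b) (φ '' polarExt s a b) := by
    rw [hdiff]
    refine hasTwoComps_of_isOpen hd hBo hEo ((isPreconnected_polarBox s a b).image _ hcontB)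
      ((isPreconnected_polarExt hba).image _ hcontE) ?_ ?_
    · exact ⟨_, mem_image_of_mem _ (hev₁ (-s / 2) ⟨by linarith, by linarith⟩)⟩
    · exact ⟨_, mem_image_of_mem _ (hev₂ (-1) (by norm_num))⟩
  refine ⟨⟨φ '' L, ⟨g, hgc, ?_, ?_, ?_, ?_, hgim.symm, _, _, hcs, ?_, ?_⟩, hcs.1⟩, ?_⟩
  · intro t ht u hu htu
    rw [hg t ht, hg u hu] at htu
    have h1 := h.injOn (hLb (hbox t ht)) (hLb (hbox u hu)) htu
    have hmem : ∀ t, boxPath s a b t ∈ univ ×ℂ Icc a b := by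
      intro t
      obtain ⟨h0, h1⟩ := boxHeight_mem t
      rw [mem_reProdIm, boxPath_im]
      refine ⟨trivial, ?_, ?_⟩ <;> nlinarith
    exact boxPath_injOn hs hab ht hu (exp_injOn_strip hba (hmem t) (hmem u) h1)
  · intro t ht
    rw [hg t ht]
    exact h.mem (hLb (hbox t ht))
  · rw [hg0]; exact h.landing_mem_frontier_self hp
  · rw [hg1]; exact h.landing_mem_frontier_self hq
  · refine ⟨q₁, h.landing_mem_frontier hBU hl₁ ?_, h.landing_mem_frontier_self hl₁,
      hnot _ (h.radial_notMem hl₁) (by simpa using hq₁)⟩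
    filter_upwards [Ioo_mem_nhdsLT (show -s < 0 by linarith)] with x hx
    exact mem_image_of_mem _ (hev₁ x hx)
  · refine ⟨q₂, h.landing_mem_frontier hEU hl₂ ?_, h.landing_mem_frontier_self hl₂,
      hnot _ (h.radial_notMem hl₂) (by simpa using hq₂)⟩
    filter_upwards [self_mem_nhdsWithin] with x hx
    exact mem_image_of_mem _ (hev₂ x hx)
  · have hcl : IsClosed (g '' Icc 0 1) := (isCompact_Icc.image_of_continuousOn hgc).isClosed
    rw [← hgIcc]
    refine closure_minimal ?_ hcl
    rintro x ⟨⟨hx1, hx2⟩, hxU⟩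
    rw [hgIcc]
    refine Or.inl ?_
    by_contra hxL
    have hx3 : x ∈ φ '' polarExt s a b := by
      have : x ∈ U \ φ '' L := ⟨hxU, hxL⟩
      rw [hdiff] at this
      exact this.resolve_left hx2
    obtain ⟨y, hy1, hy2⟩ := mem_closure_iff.mp hx1 _ hEo hx3
    exact disjoint_left.mp hd hy2 hy1

end DiscModel

/-! ### The standard chain at a point of the circle -/

namespace DiscModel

variable {φ : ℂ → X} {U : Set X} (h : DiscModel φ U)
include h

lemma exists_crossSection_near [T3Space X] {ζ : ℂ} (hζ : ‖ζ‖ = 1) {δ : ℝ} (hδ : 0 < δ)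
    (F : Finset X) (hF : ∀ p ∈ F, p ∉ U) :
    ∃ (R : Set ℂ) (δ' : ℝ) (F' : Finset X), 0 < δ' ∧ (∀ p ∈ F', p ∉ U ∧ p ∉ F) ∧
      R ⊆ ball ζ δ ∩ ball 0 1 ∧ ball ζ δ' ∩ ball 0 1 ⊆ R ∧ IsPreconnected R ∧
      IsCrossSection U (φ '' R) ∧
      closure (bdIn U (φ '' R)) ⊆ φ '' ((ball ζ δ \ ball ζ δ') ∩ ball 0 1) ∪ F' := by
  classical
  set θ := arg ζ
  have hexp : exp ((0 : ℝ) + θ * I) = ζ := by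
    conv_rhs => rw [← norm_mul_exp_arg_mul_I ζ]
    rw [hζ, ofReal_one, one_mul, ofReal_zero, zero_add]
  have hcont : Tendsto exp (𝓝 ((0 : ℝ) + θ * I)) (𝓝 ζ) := by
    have := Complex.continuous_exp.tendsto ((0 : ℝ) + θ * I)
    rwa [hexp] at this
  obtain ⟨ε, hε, hsub⟩ := Metric.mem_nhds_iff.mp (hcont (ball_mem_nhds ζ hδ))
  set e := min (ε / 2) 1 with he
  have he0 : 0 < e := lt_min (by linarith) one_pos
  have heε : e ≤ ε / 2 := min_le_left _ _
  have he1 : e ≤ 1 := min_le_right _ _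
  obtain ⟨a, ha, p, hpF, hp⟩ := h.accessible (θ - e) θ (by linarith) F hF
  obtain ⟨b, hb, q, hqF, hq⟩ := h.accessible θ (θ + e) (by linarith) F hF
  have hab : a < b := ha.2.trans hb.1
  have hba : b < a + 2 * Real.pi := by linarith [ha.1, hb.2, Real.pi_gt_three]
  have hs : 0 < e / 2 := by linarith
  have hhull : polarHull (e / 2) a b ⊆ ball ζ δ := by
    rintro _ ⟨w, ⟨hw1, hw2⟩, rfl⟩
    rw [mem_preimage] at hw1 hw2
    refine hsub ?_
    rw [mem_ball, dist_eq_norm]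
    refine (norm_le_abs_re_add_abs_im _).trans_lt ?_
    rw [sub_re, sub_im, re_ofReal_add_mul_I, im_ofReal_add_mul_I, sub_zero]
    have h1 : |w.re| ≤ e / 2 := abs_le.mpr ⟨hw1.1, by linarith [hw1.2]⟩
    have h2 : |w.im - θ| < e :=
      abs_lt.mpr ⟨by linarith [hw2.1, ha.1], by linarith [hw2.2, hb.2]⟩
    linarith
  have hWo : IsOpen (exp '' (Ioo (-(e / 2)) (e / 2) ×ℂ Ioo a b)) :=
    isOpen_exp_image (isOpen_reProdIm isOpen_Ioo isOpen_Ioo)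
  have hWζ : ζ ∈ exp '' (Ioo (-(e / 2)) (e / 2) ×ℂ Ioo a b) := by
    refine ⟨_, ?_, hexp⟩
    rw [mem_reProdIm, re_ofReal_add_mul_I, im_ofReal_add_mul_I]
    exact ⟨⟨by linarith, by linarith⟩, ha.2, hb.1⟩
  obtain ⟨δ', hδ', hsub'⟩ := Metric.isOpen_iff.mp hWo ζ hWζ
  have hbox : ball ζ δ' ∩ ball 0 1 ⊆ polarBox (e / 2) a b := by
    rintro z ⟨hz, hz1⟩
    obtain ⟨w, hw, rfl⟩ := hsub' hz
    rw [mem_ball_zero_iff, Complex.norm_exp, Real.exp_lt_one_iff] at hz1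
    exact ⟨w, ⟨⟨hw.1.1, hz1⟩, hw.2⟩, rfl⟩
  obtain ⟨hcs, hbd⟩ := h.isCrossSection_polarBox hs hab hba hp hq
  refine ⟨polarBox (e / 2) a b, δ', {p, q}, hδ', ?_, ?_, hbox, isPreconnected_polarBox _ _ _, hcs,
    hbd.trans ?_⟩
  · intro r hr
    rw [Finset.mem_insert, Finset.mem_singleton] at hr
    rcases hr with rfl | rfl
    · exact ⟨h.radial_notMem hp, hpF⟩
    · exact ⟨h.radial_notMem hq, hqF⟩
  · exact fun z hz => ⟨hhull (polarBox_subset_polarHull _ _ _ hz),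
      polarHull_subset_ball _ _ _ (polarBox_subset_polarHull _ _ _ hz)⟩
  · refine union_subset_union (image_mono ?_) (by simp)
    rintro z ⟨hz1, hz2⟩
    have hz3 := polarHull_subset_ball _ _ _ hz1
    exact ⟨⟨hhull hz1, fun hz4 => hz2 (hbox ⟨hz4, hz3⟩)⟩, hz3⟩

end DiscModel

/-- A sequence of sets in the disc shrinking to `ζ` whose images form a chain of `U`. -/
structure IsStdChain (φ : ℂ → X) (U : Set X) (ζ : ℂ) (R : ℕ → Set ℂ) : Prop where
  subset_ball : ∀ n, R n ⊆ ball 0 1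
  isPreconnected : ∀ n, IsPreconnected (R n)
  exists_ball_subset : ∀ n, ∃ δ > 0, ball ζ δ ∩ ball 0 1 ⊆ R n
  exists_subset_ball : ∀ δ > 0, ∃ N, ∀ n ≥ N, R n ⊆ ball ζ δ
  isPEChain : IsPEChain U fun n => φ '' R n

lemma DiscModel.exists_isStdChain [T3Space X] {φ : ℂ → X} {U : Set X} (h : DiscModel φ U) {ζ : ℂ}
    (hζ : ‖ζ‖ = 1) : ∃ R, IsStdChain φ U ζ R := by
  classical
  let S := {x : ℝ × Finset X // 0 < x.1 ∧ ∀ p ∈ x.2, p ∉ U}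
  have key := fun x : S => h.exists_crossSection_near hζ x.2.1 x.1.2 x.2.2
  choose R δ' F' hδ' hF' hR hR' hpre hcs hbd using key
  let next : S → S := fun x => ⟨(min (δ' x) (x.1.1 / 2), x.1.2 ∪ F' x),
    lt_min (hδ' x) (half_pos x.2.1), fun p hp => by
      rcases Finset.mem_union.mp hp with hp | hp
      · exact x.2.2 p hp
      · exact (hF' x p hp).1⟩
  let st : ℕ → S := fun n => next^[n] ⟨(1, ∅), one_pos, by simp⟩
  have hst : ∀ n, st (n + 1) = next (st n) := fun n => Function.iterate_succ_apply' _ _ _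
  have hδs : ∀ n, (st (n + 1)).1.1 = min (δ' (st n)) ((st n).1.1 / 2) := fun n => by rw [hst]
  have hFs : ∀ n, (st (n + 1)).1.2 = (st n).1.2 ∪ F' (st n) := fun n => by rw [hst]
  have hδanti : Antitone fun n => (st n).1.1 := antitone_nat_of_succ_le fun n => by
    rw [hδs]
    exact (min_le_right _ _).trans (half_le_self (st n).2.1.le)
  have hFmono : Monotone fun n => (st n).1.2 := monotone_nat_of_le_succ fun n => by
    rw [hFs]
    exact Finset.subset_union_left
  have hδpow : ∀ n, (st n).1.1 ≤ (1 / 2) ^ n := by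
    intro n
    induction n with
    | zero => exact le_of_eq (by simp [st])
    | succ n ih =>
      rw [hδs, pow_succ]
      exact (min_le_right _ _).trans (by linarith)
  have hlt : ∀ i j, i < j → (st j).1.1 ≤ δ' (st i) := fun i j hij => by
    refine (hδanti (Nat.succ_le_of_lt hij)).trans ?_
    change (st (i + 1)).1.1 ≤ _
    rw [hδs]
    exact min_le_left _ _
  have hFlt : ∀ i j, i < j → F' (st i) ⊆ (st j).1.2 := fun i j hij => by
    refine Finset.Subset.trans ?_ (hFmono (Nat.succ_le_of_lt hij))
    change _ ⊆ (st (i + 1)).1.2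
    rw [hFs]
    exact Finset.subset_union_right
  have hanti : Antitone fun n => R (st n) := antitone_nat_of_succ_le fun n => by
    intro z hz
    have := hR _ hz
    exact hR' _ ⟨ball_subset_ball (hlt n (n + 1) n.lt_succ_self) this.1, this.2⟩
  have hdisj : ∀ i j, i < j →
      closure (bdIn U (φ '' R (st i))) ∩ closure (bdIn U (φ '' R (st j))) = ∅ := by
    intro i j hij
    rw [eq_empty_iff_forall_notMem]
    rintro x ⟨hi, hj⟩
    rcases hbd _ hi with ⟨z, hz, rfl⟩ | hi <;> rcases hbd _ hj with ⟨w, hw, hwz⟩ | hj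
    · rw [h.injOn hw.2 hz.2 hwz] at hw
      exact hz.1.2 (ball_subset_ball (hlt i j hij) hw.1.1)
    · exact (hF' _ _ hj).1 (h.mem hz.2)
    · exact (hF' _ _ hi).1 (hwz ▸ h.mem hw.2)
    · exact (hF' _ _ hj).2 (hFlt i j hij hi)
  refine ⟨fun n => R (st n), fun n => (hR _).trans inter_subset_right, fun n => hpre _,
    fun n => ⟨_, hδ' _, hR' _⟩, fun δ hδ => ?_, fun n => hcs _, fun i j hij =>
      image_mono (hanti hij), fun i j hij => ?_⟩
  · obtain ⟨N, hN⟩ := exists_pow_lt_of_lt_one hδ (show (1 / 2 : ℝ) < 1 by norm_num)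
    refine ⟨N, fun n hn => (hR _).trans (inter_subset_left.trans (ball_subset_ball ?_))⟩
    exact (hδanti hn).trans ((hδpow N).trans hN.le)
  · rcases lt_or_gt_of_ne hij with hij | hij
    · exact hdisj i j hij
    · rw [inter_comm]; exact hdisj j i hij

/-! ### Chains clustering at a point of the circle -/

/-- The arc spanning the cross-cut of a cross-section, with the properties used below. -/
structure IsCutArc (U E : Set X) (g : ℝ → X) : Prop where
  contOn : ContinuousOn g (Icc 0 1)
  mem : ∀ t ∈ Ioo (0 : ℝ) 1, g t ∈ U
  left_notMem : g 0 ∉ U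
  right_notMem : g 1 ∉ U
  bdIn_subset : bdIn U E ⊆ g '' Ioo 0 1

section CrossSection

variable {U E : Set X}

lemma _root_.IsCrossSection.subset (hE : IsCrossSection U E) : E ⊆ U := by
  obtain ⟨γ, -, x, -, rfl⟩ := hE
  exact (connectedComponentIn_subset _ _).trans sdiff_subset

lemma _root_.IsCrossSection.exists_mem_closure (hE : IsCrossSection U E) :
    ∃ x ∈ closure E, x ∈ frontier U := by
  obtain ⟨γ, ⟨g, -, -, -, -, -, -, D₁, D₂, hD, ⟨x₁, hx₁⟩, ⟨x₂, hx₂⟩⟩, x, hx, rfl⟩ := hE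
  rcases hD.2.2.2 x hx with h | h <;> rw [h]
  · exact ⟨x₁, hx₁.1.1, hx₁.2.1⟩
  · exact ⟨x₂, hx₂.1.1, hx₂.2.1⟩

lemma _root_.IsCrossSection.isOpen_and_exists_isCutArc [T2Space X] [LocallyConnectedSpace X]
    (hU : IsOpen U) (hE : IsCrossSection U E) : IsOpen E ∧ ∃ g, IsCutArc U E g := by
  obtain ⟨γ, ⟨g, hgc, -, hgU, hg0, hg1, rfl, -⟩, x, hx, rfl⟩ := hE
  rw [hU.frontier_eq] at hg0 hg1
  have hA : U \ g '' Ioo 0 1 = U \ g '' Icc 0 1 := by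
    refine Subset.antisymm ?_ (sdiff_subset_sdiff_right (image_mono Ioo_subset_Icc_self))
    rintro y ⟨hyU, hy⟩
    refine ⟨hyU, ?_⟩
    rintro ⟨t, ht, rfl⟩
    rcases eq_or_lt_of_le ht.1 with rfl | h0
    · exact hg0.2 hyU
    rcases eq_or_lt_of_le ht.2 with rfl | h1
    · exact hg1.2 hyU
    exact hy ⟨t, ⟨h0, h1⟩, rfl⟩
  have hAo : IsOpen (U \ g '' Ioo 0 1) := by
    rw [hA]
    exact hU.sdiff (isCompact_Icc.image_of_continuousOn hgc).isClosed
  refine ⟨hAo.connectedComponentIn, g, hgc, hgU, hg0.2, hg1.2, ?_⟩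
  rintro y ⟨⟨hy1, hy2⟩, hyU⟩
  by_contra hyg
  have hyA : y ∈ U \ g '' Ioo 0 1 := ⟨hyU, hyg⟩
  obtain ⟨z, hz1, hz2⟩ := mem_closure_iff.mp hy1 _ hAo.connectedComponentIn
    (mem_connectedComponentIn hyA)
  rw [connectedComponentIn_eq hz2, ← connectedComponentIn_eq hz1] at hy2
  exact hy2 (mem_connectedComponentIn hyA)

lemma subset_or_exists_mem_bdIn {C : Set X} (hE : IsOpen E) (hC : IsPreconnected C) (hCU : C ⊆ U)
    (hCE : (C ∩ E).Nonempty) : C ⊆ E ∨ ∃ x ∈ C, x ∈ bdIn U E := by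
  by_contra! hcon
  refine hcon.1 (hC.subset_left_of_subset_union hE isClosed_closure.isOpen_compl
    (disjoint_left.mpr fun x hx hx' => hx' (subset_closure hx)) ?_ hCE)
  intro x hx
  by_cases hxE : x ∈ closure E
  · by_contra hn
    exact hcon.2 x hx ⟨⟨hxE, fun hxE' => hn (Or.inl hxE')⟩, hCU hx⟩
  · exact Or.inr hxE

end CrossSection

namespace DiscModel

variable {φ : ℂ → X} {U : Set X} (h : DiscModel φ U)
include h

lemma tendsto_and_mem_closure [T2Space X] {α : ℝ → ℂ} (hα : ContinuousOn α (Ioo 0 1))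
    (hαb : ∀ t ∈ Ioo (0 : ℝ) 1, α t ∈ ball (0 : ℂ) 1) {p : X} (hpU : p ∉ U)
    (hp : Tendsto (fun t => φ (α t)) (𝓝[>] 0) (𝓝 p)) {u : ℕ → ℝ} {ζ : ℂ} {B : Set X}
    (hu : Tendsto u atTop (𝓝[>] 0)) (huα : Tendsto (α ∘ u) atTop (𝓝 ζ))
    (huB : ∀ n, φ (α (u n)) ∈ B) : Tendsto α (𝓝[>] 0) (𝓝 ζ) ∧ p ∈ closure B :=
  ⟨h.tendsto_of_mapClusterPt hα hαb hpU hp (huα.mapClusterPt.of_comp hu),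
    mem_closure_of_tendsto (hp.comp hu) (Eventually.of_forall huB)⟩

lemma exists_lift {E : Set X} {g : ℝ → X} (hg : IsCutArc U E g) :
    ∃ α : ℝ → ℂ, ContinuousOn α (Ioo 0 1) ∧ ∀ t ∈ Ioo (0 : ℝ) 1, α t ∈ ball (0 : ℂ) 1 ∧
      φ (α t) = g t := by
  have hex : ∀ t ∈ Ioo (0 : ℝ) 1, ∃ z ∈ ball (0 : ℂ) 1, φ z = g t := fun t ht => by
    have := hg.mem t ht
    rwa [← h.image_eq] at this
  choose! α hα hφ using hex
  refine ⟨α, fun t ht => ?_, fun t ht => ⟨hα t ht, hφ t ht⟩⟩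
  refine h.tendsto_of_tendsto_image ?_ (hα t ht) ?_
  · filter_upwards [self_mem_nhdsWithin] with s hs using hα s hs
  · rw [hφ t ht]
    refine ((hg.contOn t (Ioo_subset_Icc_self ht)).mono Ioo_subset_Icc_self).tendsto.congr' ?_
    filter_upwards [self_mem_nhdsWithin] with s hs using (hφ s hs).symm

lemma exists_landing_of_not_subset [T2Space X] [LocallyConnectedSpace X] {ζ : ℂ} (hζ : ‖ζ‖ = 1)
    {R : ℕ → Set ℂ} (hR : IsStdChain φ U ζ R) {E : Set X} (hE : IsCrossSection U E)
    (hcl : ζ ∈ closure (ball 0 1 ∩ φ ⁻¹' E)) (hns : ∀ m, ¬ φ '' R m ⊆ E) :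
    ∃ p ∈ closure (bdIn U E), ∃ γ : ℝ → ℂ, ContinuousOn γ (Ioo 0 1) ∧
      (∀ t ∈ Ioo (0 : ℝ) 1, γ t ∈ ball (0 : ℂ) 1) ∧ Tendsto γ (𝓝[>] 0) (𝓝 ζ) ∧
      Tendsto (fun t => φ (γ t)) (𝓝[>] 0) (𝓝 p) := by
  obtain ⟨hEo, g, hg⟩ := hE.isOpen_and_exists_isCutArc h.isOpen
  obtain ⟨α, hα, hαg⟩ := h.exists_lift hg
  have key : ∀ m, ∃ t ∈ Ioo (0 : ℝ) 1, g t ∈ bdIn U E ∧ α t ∈ R m := by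
    intro m
    obtain ⟨δ, hδ, hsub⟩ := hR.exists_ball_subset m
    obtain ⟨z, hz1, hz2, hz3⟩ := mem_closure_iff.mp hcl _ isOpen_ball (mem_ball_self hδ)
    have himg : φ '' R m ⊆ U := by
      rintro _ ⟨w, hw, rfl⟩
      exact h.mem (hR.subset_ball m hw)
    obtain ⟨x, ⟨w, hw, rfl⟩, hxE⟩ := (subset_or_exists_mem_bdIn hEo
      ((hR.isPreconnected m).image _ (h.contOn.mono (hR.subset_ball m))) himg
      ⟨φ z, mem_image_of_mem _ (hsub ⟨hz1, hz2⟩), hz3⟩).resolve_left (hns m)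
    obtain ⟨t, ht, htx⟩ := hg.bdIn_subset hxE
    refine ⟨t, ht, htx ▸ hxE, ?_⟩
    rwa [h.injOn (hαg t ht).1 (hR.subset_ball m hw) ((hαg t ht).2.trans htx)]
  choose u hu hub huR using key
  have huζ : Tendsto (α ∘ u) atTop (𝓝 ζ) := by
    rw [Metric.tendsto_atTop]
    intro δ hδ
    obtain ⟨N, hN⟩ := hR.exists_subset_ball δ hδ
    exact ⟨N, fun n hn => hN n hn (huR n)⟩
  obtain ⟨t, ht, ψ, hψ, hlim⟩ := isCompact_Icc.tendsto_subseq fun n => Ioo_subset_Icc_self (hu n)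
  have huψ : Tendsto (α ∘ (u ∘ ψ)) atTop (𝓝 ζ) := huζ.comp hψ.tendsto_atTop
  have hIoo : Ioo (0 : ℝ) 1 ∈ 𝓝[>] (0 : ℝ) := Ioo_mem_nhdsGT one_pos
  rcases eq_or_lt_of_le ht.1 with rfl | h0
  · have hp : Tendsto (fun t => φ (α t)) (𝓝[>] 0) (𝓝 (g 0)) := by
      have h1 := (hg.contOn 0 ht).mono Ioo_subset_Icc_self
      rw [ContinuousWithinAt, nhdsWithin_Ioo_eq_nhdsGT one_pos] at h1
      exact h1.congr' (by filter_upwards [hIoo] with s hs using (hαg s hs).2.symm)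
    have hu0 : Tendsto (u ∘ ψ) atTop (𝓝[>] 0) :=
      tendsto_nhdsWithin_iff.mpr ⟨hlim, Eventually.of_forall fun n => (hu _).1⟩
    obtain ⟨h1, h2⟩ := h.tendsto_and_mem_closure hα (fun s hs => (hαg s hs).1) hg.left_notMem hp
      hu0 huψ (fun n => by
        rw [Function.comp_apply, (hαg _ (hu _)).2]; exact hub _)
    exact ⟨g 0, h2, α, hα, fun s hs => (hαg s hs).1, h1, hp⟩
  rcases eq_or_lt_of_le ht.2 with rfl | h1
  · have hrefl : ∀ s ∈ Ioo (0 : ℝ) 1, 1 - s ∈ Ioo (0 : ℝ) 1 := fun s hs =>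
      ⟨by linarith [hs.2], by linarith [hs.1]⟩
    have hcr : Continuous fun s : ℝ => 1 - s := by fun_prop
    have hβ : ContinuousOn (fun s => α (1 - s)) (Ioo 0 1) := hα.comp hcr.continuousOn hrefl
    have hp : Tendsto (fun t => φ (α (1 - t))) (𝓝[>] 0) (𝓝 (g 1)) := by
      have h1 := (hg.contOn 1 ht).mono Ioo_subset_Icc_self
      have h2 : Tendsto (fun s : ℝ => 1 - s) (𝓝[>] 0) (𝓝[Ioo 0 1] 1) := by
        refine tendsto_nhdsWithin_iff.mpr ⟨?_, ?_⟩
        · simpa using (hcr.tendsto 0).mono_left nhdsWithin_le_nhds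
        · filter_upwards [hIoo] with s hs using hrefl s hs
      refine (h1.tendsto.comp h2).congr' ?_
      filter_upwards [hIoo] with s hs using (hαg _ (hrefl s hs)).2.symm
    have hu0 : Tendsto (fun n => 1 - u (ψ n)) atTop (𝓝[>] 0) := by
      refine tendsto_nhdsWithin_iff.mpr ⟨?_, Eventually.of_forall fun n => (hrefl _ (hu _)).1⟩
      simpa [Function.comp_def] using (hcr.tendsto 1).comp hlim
    obtain ⟨h1, h2⟩ := h.tendsto_and_mem_closure (u := fun n => 1 - u (ψ n)) (ζ := ζ)
      (B := bdIn U E) hβ (fun s hs => (hαg _ (hrefl s hs)).1)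
      hg.right_notMem hp hu0 (by simpa [Function.comp_def] using huψ) (fun n => by
        rw [sub_sub_cancel, (hαg _ (hu _)).2]; exact hub _)
    exact ⟨g 1, h2, _, hβ, fun s hs => (hαg _ (hrefl s hs)).1, h1, hp⟩
  · exfalso
    have h2 : Tendsto (α ∘ (u ∘ ψ)) atTop (𝓝 (α t)) :=
      (hα.continuousAt (Ioo_mem_nhds h0 h1)).tendsto.comp hlim
    have h3 := (hαg t ⟨h0, h1⟩).1
    rw [← tendsto_nhds_unique huψ h2, mem_ball_zero_iff, hζ] at h3
    exact lt_irrefl _ h3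

/-- A chain clustering at `ζ` is divided by the standard chain at `ζ`. -/
lemma chainDivides_of_mem_closure [T2Space X] [LocallyConnectedSpace X] {ζ : ℂ} (hζ : ‖ζ‖ = 1)
    {R : ℕ → Set ℂ} (hR : IsStdChain φ U ζ R) {E : ℕ → Set X} (hE : IsPEChain U E)
    (hcl : ∀ n, ζ ∈ closure (ball 0 1 ∩ φ ⁻¹' E n)) :
    ChainDivides (fun n => φ '' R n) E := by
  intro n
  by_contra! hcon
  have hcon' : ∀ m, ¬ φ '' R m ⊆ E (n + 1) := fun m hm =>
    hcon m (hm.trans (hE.2.1 _ _ n.le_succ))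
  obtain ⟨p, hp, γ, h1, h2, h3, h4⟩ := h.exists_landing_of_not_subset hζ hR (hE.1 n) (hcl n) hcon
  obtain ⟨q, hq, η, h1', h2', h3', h4'⟩ :=
    h.exists_landing_of_not_subset hζ hR (hE.1 (n + 1)) (hcl _) hcon'
  have hpq := h.unique_landing ζ hζ p q γ η h1 h1' h2 h2' h3 h3' h4 h4'
  have hmem : p ∈ closure (bdIn U (E n)) ∩ closure (bdIn U (E (n + 1))) := ⟨hp, hpq ▸ hq⟩
  rw [hE.2.2 n (n + 1) (by omega)] at hmem
  exact hmem

end DiscModel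

/-! ### Prime ends as points of the circle -/

lemma _root_.IsCrossSection.nonempty {U E : Set X} (hE : IsCrossSection U E) : E.Nonempty := by
  obtain ⟨x, hx, -⟩ := hE.exists_mem_closure
  exact closure_nonempty_iff.mp ⟨x, hx⟩

lemma chainDivides_refl {Y : Type*} (D : ℕ → Set Y) : ChainDivides D D := fun n => ⟨n, Subset.rfl⟩

lemma chainDivides_trans {Y : Type*} {D D' D'' : ℕ → Set Y} (h : ChainDivides D D')
    (h' : ChainDivides D' D'') : ChainDivides D D'' := fun n => by
  obtain ⟨m, hm⟩ := h' n
  obtain ⟨k, hk⟩ := h m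
  exact ⟨k, hk.trans hm⟩

lemma quot_mk_eq_iff {U : Set X} (C C' : PrimeChain U) :
    (Quot.mk _ C : PrimeEnd U) = Quot.mk _ C' ↔
      ChainDivides C.1 C'.1 ∧ ChainDivides C'.1 C.1 :=
  Equivalence.quot_mk_eq_iff
    (r := fun C C' : PrimeChain U => ChainDivides C.1 C'.1 ∧ ChainDivides C'.1 C.1)
    ⟨fun _ => ⟨chainDivides_refl _, chainDivides_refl _⟩, fun h => ⟨h.2, h.1⟩,
      fun h h' => ⟨chainDivides_trans h.1 h'.1, chainDivides_trans h'.2 h.2⟩⟩ _ _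

lemma mem_closure_ball {ζ : ℂ} (hζ : ‖ζ‖ = 1) : ζ ∈ closure (ball (0 : ℂ) 1) := by
  rw [closure_ball _ one_ne_zero, mem_closedBall_zero_iff, hζ]

namespace IsStdChain

variable {φ : ℂ → X} {U : Set X} {ζ : ℂ} {R : ℕ → Set ℂ}

lemma mem_closure (hR : IsStdChain φ U ζ R) (hζ : ‖ζ‖ = 1) (n : ℕ) : ζ ∈ closure (R n) := by
  obtain ⟨δ, hδ, hsub⟩ := hR.exists_ball_subset n
  exact closure_mono hsub (isOpen_ball.inter_closure ⟨mem_ball_self hδ, mem_closure_ball hζ⟩)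

lemma mem_closure_of_chainDivides (hR : IsStdChain φ U ζ R)
    {E : ℕ → Set X} (hE : IsPEChain U E) (hd : ChainDivides E fun n => φ '' R n) (n : ℕ) :
    ζ ∈ closure (ball 0 1 ∩ φ ⁻¹' E n) := by
  rw [Metric.mem_closure_iff]
  intro δ hδ
  obtain ⟨N, hN⟩ := hR.exists_subset_ball δ hδ
  obtain ⟨m, hm⟩ := hd N
  obtain ⟨x, hx⟩ := (hE.1 (max m n)).nonempty
  obtain ⟨z, hz, rfl⟩ := hm (hE.2.1 _ m (le_max_left _ _) hx)
  exact ⟨z, ⟨hR.subset_ball N hz, hE.2.1 _ n (le_max_right _ _) hx⟩,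
    mem_ball'.mp (hN N le_rfl hz)⟩

end IsStdChain

namespace DiscModel

variable {φ : ℂ → X} {U : Set X} (h : DiscModel φ U)
include h

lemma isPrimeChain_std [T2Space X] [LocallyConnectedSpace X] {ζ : ℂ} (hζ : ‖ζ‖ = 1)
    {R : ℕ → Set ℂ} (hR : IsStdChain φ U ζ R) : IsPrimeChain U fun n => φ '' R n :=
  ⟨hR.isPEChain, fun _ hE hd =>
    h.chainDivides_of_mem_closure hζ hR hE (hR.mem_closure_of_chainDivides hE hd)⟩

lemma exists_mem_closure_of_isPEChain [T2Space X] {E : ℕ → Set X} (hE : IsPEChain U E) :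
    ∃ ζ : ℂ, ‖ζ‖ = 1 ∧ ∀ n, ζ ∈ closure (ball 0 1 ∩ φ ⁻¹' E n) := by
  let K : ℕ → Set ℂ := fun n => closure (ball 0 1 ∩ φ ⁻¹' E n) ∩ sphere 0 1
  have hKc : ∀ n, IsClosed (K n) := fun n => isClosed_closure.inter isClosed_sphere
  have hne : ∀ n, (K n).Nonempty := by
    intro n
    obtain ⟨x, hx, hxU⟩ := (hE.1 n).exists_mem_closure
    rw [h.isOpen.frontier_eq] at hxU
    have := mem_closure_iff_nhdsWithin_neBot.mp hx
    have hex : ∀ y ∈ E n, ∃ z ∈ ball (0 : ℂ) 1, φ z = y := fun y hy => by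
      have := (hE.1 n).subset hy
      rwa [← h.image_eq] at this
    choose! z hz hφ using hex
    have hev : ∀ᶠ y in 𝓝[E n] x, y ∈ E n := self_mem_nhdsWithin
    have ht : Tendsto (fun y => φ (z y)) (𝓝[E n] x) (𝓝 x) := by
      refine (tendsto_id.mono_left nhdsWithin_le_nhds).congr' ?_
      filter_upwards [hev] with y hy using (hφ y hy).symm
    obtain ⟨ζ, hζ, hcl⟩ := (isCompact_closedBall (0 : ℂ) 1).exists_mapClusterPt
      (f := 𝓝[E n] x) (u := z)
      (le_principal_iff.mpr (hev.mono fun y hy => ball_subset_closedBall (hz y hy)))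
    refine ⟨ζ, ?_, ?_⟩
    · exact isClosed_closure.mem_of_mapClusterPt hcl
        (hev.mono fun y hy => subset_closure ⟨hz y hy, by rw [mem_preimage, hφ y hy]; exact hy⟩)
    · rw [mem_sphere_zero_iff_norm]
      refine le_antisymm (mem_closedBall_zero_iff.mp hζ)
        (le_of_forall_lt_imp_le_of_dense fun r hr => ?_)
      have hclosed : IsClosed {z : ℂ | r ≤ ‖z‖} := isClosed_le continuous_const continuous_norm
      exact hclosed.mem_of_mapClusterPt hcl
        ((h.eventually_lt_norm hxU.2 ht hr).mono fun y hy => hy.le)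
  obtain ⟨ζ, hζ⟩ := IsCompact.nonempty_iInter_of_sequence_nonempty_isCompact_isClosed K
    (fun n => inter_subset_inter_left _ (closure_mono (inter_subset_inter_right _
      (preimage_mono (hE.2.1 _ _ n.le_succ))))) hne
    ((isCompact_sphere (0 : ℂ) 1).of_isClosed_subset (hKc 0) inter_subset_right) hKc
  rw [mem_iInter] at hζ
  exact ⟨ζ, mem_sphere_zero_iff_norm.mp (hζ 0).2, fun n => (hζ n).1⟩

/-- The prime end of `U` corresponding to a point of the circle. -/
lemma exists_circle_param [T3Space X] [LocallyConnectedSpace X] :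
    ∃ (R : sphere (0 : ℂ) 1 → ℕ → Set ℂ) (e : sphere (0 : ℂ) 1 → PrimeEnd U),
      (∀ ζ : sphere (0 : ℂ) 1, IsStdChain φ U ζ (R ζ)) ∧ Function.Bijective e ∧
      ∀ ζ E, PrimeEndDivides (e ζ) E ↔ ∃ m, φ '' R ζ m ⊆ E := by
  have hnorm : ∀ ζ : sphere (0 : ℂ) 1, ‖(ζ : ℂ)‖ = 1 := fun ζ => mem_sphere_zero_iff_norm.mp ζ.2
  choose R hR using fun ζ : sphere (0 : ℂ) 1 => h.exists_isStdChain (hnorm ζ)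
  let e : sphere (0 : ℂ) 1 → PrimeEnd U := fun ζ =>
    Quot.mk _ ⟨fun n => φ '' R ζ n, h.isPrimeChain_std (hnorm ζ) (hR ζ)⟩
  refine ⟨R, e, hR, ⟨?_, ?_⟩, ?_⟩
  · intro ζ ξ hζξ
    have hd := ((quot_mk_eq_iff _ _).mp hζξ).1
    have hcl := (hR ξ).mem_closure_of_chainDivides (hR ζ).isPEChain hd
    by_contra hne
    have hpos : 0 < dist (ζ : ℂ) ξ / 2 := half_pos (dist_pos.mpr (Subtype.coe_ne_coe.mpr hne))
    obtain ⟨N, hN⟩ := (hR ζ).exists_subset_ball _ hpos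
    have hsub : ball 0 1 ∩ φ ⁻¹' (φ '' R ζ N) ⊆ closedBall (ζ : ℂ) (dist (ζ : ℂ) ξ / 2) := by
      rintro z ⟨hz, w, hw, hwz⟩
      rw [← h.injOn ((hR ζ).subset_ball N hw) hz hwz]
      exact ball_subset_closedBall (hN N le_rfl hw)
    have := mem_closedBall'.mp (closure_minimal hsub isClosed_closedBall (hcl N))
    linarith
  · intro p
    induction p using Quot.ind with
    | mk C =>
      obtain ⟨ζ, hζ, hcl⟩ := h.exists_mem_closure_of_isPEChain C.2.1
      have hd := h.chainDivides_of_mem_closure hζ (hR ⟨ζ, mem_sphere_zero_iff_norm.mpr hζ⟩)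
        C.2.1 hcl
      exact ⟨⟨ζ, mem_sphere_zero_iff_norm.mpr hζ⟩, (quot_mk_eq_iff _ _).mpr
        ⟨hd, C.2.2 _ (hR _).isPEChain hd⟩⟩
  · intro ζ E
    constructor
    · rintro ⟨C, hC, N, hN⟩
      obtain ⟨m, hm⟩ := ((quot_mk_eq_iff _ _).mp hC).2 N
      exact ⟨m, hm.trans (hN N le_rfl)⟩
    · rintro ⟨m, hm⟩
      exact ⟨_, rfl, m, fun i hi => ((hR ζ).isPEChain.2.1 i m hi).trans hm⟩

end DiscModel

open Classical in
/-- The map from the closed disc to the prime ends compactification given by a map `φ` of the open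
disc and a map `e` of the circle. -/
def discMap {φ : ℂ → X} {U : Set X} (h : DiscModel φ U) (e : sphere (0 : ℂ) 1 → PrimeEnd U)
    (z : closedBall (0 : ℂ) 1) : PrimeEndComp U :=
  if hz : (z : ℂ) ∈ ball (0 : ℂ) 1 then pePt U ⟨φ z, h.mem hz⟩ else
    peEnd U (e ⟨z, by
      rw [mem_sphere_zero_iff_norm]
      exact le_antisymm (mem_closedBall_zero_iff.mp z.2)
        (not_lt.mp fun hlt => hz (mem_ball_zero_iff.mpr hlt))⟩)

section DiscMap

variable {φ : ℂ → X} {U : Set X} (h : DiscModel φ U) (e : sphere (0 : ℂ) 1 → PrimeEnd U)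

lemma discMap_of_mem_ball {z : ℂ} (hz : z ∈ ball (0 : ℂ) 1) :
    discMap h e ⟨z, ball_subset_closedBall hz⟩ = pePt U ⟨φ z, h.mem hz⟩ := dif_pos hz

lemma discMap_of_mem_sphere (ζ : sphere (0 : ℂ) 1) :
    discMap h e ⟨ζ, sphere_subset_closedBall ζ.2⟩ = peEnd U (e ζ) :=
  dif_neg (sphere_disjoint_ball.notMem_of_mem_left ζ.2)

lemma mem_ball_or_mem_sphere (z : closedBall (0 : ℂ) 1) :
    (∃ w, ∃ hw : w ∈ ball (0 : ℂ) 1, z = ⟨w, ball_subset_closedBall hw⟩) ∨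
      ∃ ζ : sphere (0 : ℂ) 1, z = ⟨ζ, sphere_subset_closedBall ζ.2⟩ := by
  rcases z with ⟨z, hz⟩
  rcases (mem_closedBall.mp hz).lt_or_eq with hlt | heq
  · exact Or.inl ⟨z, hlt, rfl⟩
  · exact Or.inr ⟨⟨z, heq⟩, rfl⟩

lemma pePt_mem_peOpen {V : Set X} (x : U) : pePt U x ∈ peOpen U V ↔ (x : X) ∈ V :=
  ⟨fun ⟨_, hy, hyV⟩ => Sum.inl_injective hy ▸ hyV, fun hx => ⟨x, rfl, hx⟩⟩

lemma peEnd_notMem_peOpen {V : Set X} (p : PrimeEnd U) : peEnd U p ∉ peOpen U V :=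
  fun ⟨_, hy, _⟩ => Sum.inr_ne_inl hy

lemma pePt_mem_peSection {E : Set X} (x : U) : pePt U x ∈ peSection U E ↔ (x : X) ∈ E :=
  ⟨fun hx => hx.elim (pePt_mem_peOpen x).mp fun ⟨_, hp, _⟩ => absurd hp Sum.inl_ne_inr,
    fun hx => Or.inl ((pePt_mem_peOpen x).mpr hx)⟩

lemma peEnd_mem_peSection {E : Set X} (p : PrimeEnd U) :
    peEnd U p ∈ peSection U E ↔ PrimeEndDivides p E :=
  ⟨fun hx => hx.elim (fun h => absurd h (peEnd_notMem_peOpen p))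
    fun ⟨_, hq, hqE⟩ => Sum.inr_injective hq ▸ hqE, fun hp => Or.inr ⟨p, rfl, hp⟩⟩

lemma discMap_bijective (he : Function.Bijective e) : Function.Bijective (discMap h e) := by
  constructor
  · intro z w hzw
    rcases mem_ball_or_mem_sphere z with ⟨z, hz, rfl⟩ | ⟨z, rfl⟩ <;>
      rcases mem_ball_or_mem_sphere w with ⟨w, hw, rfl⟩ | ⟨w, rfl⟩
    · rw [discMap_of_mem_ball h e hz, discMap_of_mem_ball h e hw] at hzw
      have := Sum.inl_injective hzw
      rw [Subtype.mk.injEq] at this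
      exact Subtype.ext (h.injOn hz hw this)
    · rw [discMap_of_mem_ball h e hz, discMap_of_mem_sphere] at hzw
      exact absurd hzw Sum.inl_ne_inr
    · rw [discMap_of_mem_ball h e hw, discMap_of_mem_sphere] at hzw
      exact absurd hzw Sum.inr_ne_inl
    · rw [discMap_of_mem_sphere, discMap_of_mem_sphere] at hzw
      rw [he.1 (Sum.inr_injective hzw)]
  · rintro (⟨x, hx⟩ | p)
    · have hx' := hx
      rw [← h.image_eq] at hx'
      obtain ⟨z, hz, rfl⟩ := hx'
      exact ⟨_, discMap_of_mem_ball h e hz⟩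
    · obtain ⟨ζ, rfl⟩ := he.2 p
      exact ⟨_, discMap_of_mem_sphere h e ζ⟩

variable {e} {R : sphere (0 : ℂ) 1 → ℕ → Set ℂ}
  (hR : ∀ ζ : sphere (0 : ℂ) 1, IsStdChain φ U ζ (R ζ))
  (hdiv : ∀ ζ E, PrimeEndDivides (e ζ) E ↔ ∃ m, φ '' R ζ m ⊆ E)
include hR hdiv

lemma continuous_discMap [T2Space X] [LocallyConnectedSpace X] : Continuous (discMap h e) := by
  have hpre : ∀ V : Set X, IsOpen V → IsOpen (ball (0 : ℂ) 1 ∩ φ ⁻¹' V) := fun V hV =>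
    h.contOn.isOpen_inter_preimage isOpen_ball hV
  refine continuous_generateFrom_iff.mpr ?_
  rintro _ (⟨V, hV, -, rfl⟩ | ⟨E, hE, rfl⟩)
  · convert (hpre V hV).preimage continuous_subtype_val using 1
    ext z
    rcases mem_ball_or_mem_sphere z with ⟨z, hz, rfl⟩ | ⟨ζ, rfl⟩
    · rw [mem_preimage, discMap_of_mem_ball h e hz, pePt_mem_peOpen]
      exact ⟨fun hzV => ⟨hz, hzV⟩, fun hzV => hzV.2⟩
    · rw [mem_preimage, discMap_of_mem_sphere]
      exact ⟨fun hζ => absurd hζ (peEnd_notMem_peOpen _), fun hζ =>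
        absurd hζ.1 (sphere_disjoint_ball.notMem_of_mem_left ζ.2)⟩
  · have hEo := (hE.isOpen_and_exists_isCutArc h.isOpen).1
    rw [isOpen_iff_mem_nhds]
    intro z hz
    rcases mem_ball_or_mem_sphere z with ⟨z, hzb, rfl⟩ | ⟨ζ, rfl⟩
    · rw [mem_preimage, discMap_of_mem_ball h e hzb, pePt_mem_peSection] at hz
      filter_upwards [((hpre E hEo).preimage continuous_subtype_val).mem_nhds
        (show _ from ⟨hzb, hz⟩)] with w hw
      rw [mem_preimage, show w = ⟨w.1, ball_subset_closedBall hw.1⟩ from rfl,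
        discMap_of_mem_ball h e hw.1, pePt_mem_peSection]
      exact hw.2
    · rw [mem_preimage, discMap_of_mem_sphere, peEnd_mem_peSection, hdiv] at hz
      obtain ⟨m, hm⟩ := hz
      obtain ⟨δ, hδ, hsub⟩ := (hR ζ).exists_ball_subset m
      filter_upwards [(isOpen_ball.preimage continuous_subtype_val).mem_nhds
        (show (⟨ζ, sphere_subset_closedBall ζ.2⟩ : closedBall (0 : ℂ) 1) ∈
          Subtype.val ⁻¹' ball (ζ : ℂ) δ from mem_ball_self hδ)] with w hw
      rcases mem_ball_or_mem_sphere w with ⟨w, hwb, rfl⟩ | ⟨ξ, rfl⟩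
      · rw [mem_preimage, discMap_of_mem_ball h e hwb, pePt_mem_peSection]
        exact hm (mem_image_of_mem _ (hsub ⟨hw, hwb⟩))
      · rw [mem_preimage, discMap_of_mem_sphere, peEnd_mem_peSection, hdiv]
        obtain ⟨ε, hε, hεs⟩ := Metric.isOpen_iff.mp (isOpen_ball (x := (ζ : ℂ))) _ hw
        obtain ⟨N, hN⟩ := (hR ξ).exists_subset_ball ε hε
        exact ⟨N, (image_mono fun w hw =>
          hsub ⟨hεs (hN N le_rfl hw), (hR ξ).subset_ball N hw⟩).trans hm⟩

lemma isOpenMap_discMap (he : Function.Bijective e) : IsOpenMap (discMap h e) := by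
  refine IsOpenMap.of_nhds_le fun z S hS => ?_
  obtain ⟨δ, hδ, hsub⟩ := Metric.mem_nhds_iff.mp (mem_map.mp hS)
  rcases mem_ball_or_mem_sphere z with ⟨z, hz, rfl⟩ | ⟨ζ, rfl⟩
  · have hVo : IsOpen (ball z δ ∩ ball 0 1) := isOpen_ball.inter isOpen_ball
    have hV : IsOpen (peOpen U (φ '' (ball z δ ∩ ball 0 1))) :=
      TopologicalSpace.isOpen_generateFrom_of_mem (Or.inl ⟨_, h.isOpen_image _ hVo
        inter_subset_right, by rintro _ ⟨w, hw, rfl⟩; exact h.mem hw.2, rfl⟩)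
    refine mem_of_superset (hV.mem_nhds ?_) ?_
    · rw [discMap_of_mem_ball h e hz, pePt_mem_peOpen]
      exact mem_image_of_mem _ ⟨mem_ball_self hδ, hz⟩
    · rintro _ ⟨⟨_, _⟩, rfl, w, hw, rfl⟩
      rw [← discMap_of_mem_ball h e hw.2]
      exact hsub hw.1
  · obtain ⟨N, hN⟩ := (hR ζ).exists_subset_ball (δ / 2) (half_pos hδ)
    have hV : IsOpen (peSection U (φ '' R ζ N)) :=
      TopologicalSpace.isOpen_generateFrom_of_mem (Or.inr ⟨_, (hR ζ).isPEChain.1 N, rfl⟩)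
    refine mem_of_superset (hV.mem_nhds ?_) ?_
    · rw [discMap_of_mem_sphere, peEnd_mem_peSection, hdiv]
      exact ⟨N, Subset.rfl⟩
    · rintro x hx
      obtain ⟨w, rfl⟩ := (discMap_bijective h e he).2 x
      refine hsub ?_
      rcases mem_ball_or_mem_sphere w with ⟨w, hw, rfl⟩ | ⟨ξ, rfl⟩
      · rw [discMap_of_mem_ball h e hw, pePt_mem_peSection] at hx
        obtain ⟨v, hv, hvw⟩ := hx
        rw [h.injOn ((hR ζ).subset_ball N hv) hw hvw] at hv
        exact ball_subset_ball (half_le_self hδ.le) (hN N le_rfl hv)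
      · rw [discMap_of_mem_sphere, peEnd_mem_peSection, hdiv] at hx
        obtain ⟨m, hm⟩ := hx
        have h1 := (h.injOn.image_subset_image_iff ((hR ξ).subset_ball m)
          ((hR ζ).subset_ball N)).mp hm
        have h2 := closure_mono (h1.trans (hN N le_rfl))
          ((hR ξ).mem_closure (mem_sphere_zero_iff_norm.mp ξ.2) m)
        exact mem_ball.mpr ((mem_closedBall.mp (closure_ball_subset_closedBall h2)).trans_lt
          (half_lt_self hδ))

end DiscMap

/-- The prime ends compactification of a set with a disc model is the closed disc. -/
theorem DiscModel.nonempty_homeomorph [T3Space X] [LocallyConnectedSpace X] {φ : ℂ → X} {U : Set X}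
    (h : DiscModel φ U) : Nonempty (PrimeEndCircle U ≃ₜ sphere (0 : ℂ) 1) ∧
      Nonempty (PrimeEndComp U ≃ₜ closedBall (0 : ℂ) 1) := by
  obtain ⟨R, e, hR, he, hdiv⟩ := h.exists_circle_param
  let H : closedBall (0 : ℂ) 1 ≃ₜ PrimeEndComp U :=
    (Equiv.ofBijective _ (discMap_bijective h e he)).toHomeomorphOfContinuousOpen
      (continuous_discMap h hR hdiv) (isOpenMap_discMap h hR hdiv he)
  have hH : ∀ z : closedBall (0 : ℂ) 1, (z : ℂ) ∈ sphere (0 : ℂ) 1 ↔ H z ∈ PrimeEndCircle U := by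
    intro z
    change _ ↔ discMap h e z ∈ PrimeEndCircle U
    rcases mem_ball_or_mem_sphere z with ⟨z, hz, rfl⟩ | ⟨ζ, rfl⟩
    · rw [discMap_of_mem_ball h e hz]
      exact ⟨fun hζ => absurd hz (sphere_disjoint_ball.notMem_of_mem_left hζ),
        by rintro ⟨p, hp⟩; exact absurd hp Sum.inr_ne_inl⟩
    · rw [discMap_of_mem_sphere]
      exact ⟨fun _ => ⟨_, rfl⟩, fun _ => ζ.2⟩
  let S : {z : closedBall (0 : ℂ) 1 // (z : ℂ) ∈ sphere (0 : ℂ) 1} ≃ₜ sphere (0 : ℂ) 1 :=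
    { toFun := fun z => ⟨z.1.1, z.2⟩
      invFun := fun ζ => ⟨⟨ζ, sphere_subset_closedBall ζ.2⟩, ζ.2⟩
      left_inv := fun _ => rfl
      right_inv := fun _ => rfl
      continuous_toFun := by fun_prop
      continuous_invFun := by fun_prop }
  exact ⟨⟨(H.subtype hH).symm.trans S⟩, ⟨H.symm⟩⟩

/-! ### Transfer to the plane -/

/-- The Riemann map of a plane domain, transported along a homeomorphism, is a disc model. -/
theorem exists_discModel {Y : Type*} [TopologicalSpace Y] (e : ℂ ≃ₜ Y) {U : Set Y}
    (hU : IsOpen U) (hUc : IsSimplyConnected U) (hne : U ≠ univ) : ∃ φ, DiscModel φ U := by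
  obtain ⟨f, k, a, w, C, h⟩ := exists_discParam (U := e ⁻¹' U) (hU.preimage e.continuous)
    (e.isSimplyConnected_preimage.mpr hUc) (by simpa using hne)
  have lift : ∀ {γ : ℝ → ℂ} {l : Filter ℝ} {q : Y},
      Tendsto (fun t => (e ∘ f) (γ t)) l (𝓝 q) → Tendsto (fun t => f (γ t)) l (𝓝 (e.symm q)) :=
    fun {_ _ q} ht => by simpa [Function.comp_def] using (e.symm.continuous.tendsto q).comp ht
  refine ⟨e ∘ f, e.continuous.comp_continuousOn h.contOn, e.injective.comp_injOn h.injOn, ?_, ?_,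
    ?_, ?_⟩
  · rw [image_comp, h.image_eq, image_preimage_eq _ e.surjective]
  · intro V hV hVb
    rw [image_comp]
    exact e.isOpenMap _ (h.isOpen_image V hV hVb)
  · intro α b hαb F hF
    obtain ⟨θ, hθ, q, hq, ht⟩ := h.exists_radial_limit hαb (F.map e.symm.toEquiv.toEmbedding)
      (by simpa using fun p hp => hF (e p) hp)
    refine ⟨θ, hθ, e q, fun hqF => hq ?_, (e.continuous.tendsto q).comp ht⟩
    simpa using hqF
  · intro ζ hζ p q γ η hγ hη hγb hηb hγt hηt hp hq
    exact e.symm.injective (h.unique_landing hζ hγ hη hγb hηb hγt hηt (lift hp) (lift hq))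

/-- The isometry between `ℂ` and the Euclidean plane identifies the unit circles and the closed
unit discs. -/
lemma nonempty_homeomorph_sphere_closedBall :
    Nonempty (sphere (0 : ℂ) 1 ≃ₜ sphere (0 : EuclideanSpace ℝ (Fin 2)) 1) ∧
      Nonempty (closedBall (0 : ℂ) 1 ≃ₜ closedBall (0 : EuclideanSpace ℝ (Fin 2)) 1) :=
  ⟨⟨Complex.orthonormalBasisOneI.repr.toHomeomorph.subtype fun z => by simp⟩,
    ⟨Complex.orthonormalBasisOneI.repr.toHomeomorph.subtype fun z => by simp⟩⟩

end PrimeEnds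

/-- Prime ends compactification theorem, plane case: the circle of prime
ends is homeomorphic to `S¹` and the prime ends compactification is homeomorphic to the
closed unit disk. -/
theorem prime_ends_compactification_plane
    (U : Set (ℝ × ℝ)) (hUopen : IsOpen U) (hUsc : SimplyConnectedSpace ↥U)
    (hUcompl : Set.Nontrivial Uᶜ) :
    Nonempty (↥(PrimeEndCircle U) ≃ₜ ↥(Metric.sphere (0 : EuclideanSpace ℝ (Fin 2)) 1)) ∧
      Nonempty (PrimeEndComp U ≃ₜ ↥(Metric.closedBall (0 : EuclideanSpace ℝ (Fin 2)) 1)) := by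
  obtain ⟨φ, h⟩ := PrimeEnds.exists_discModel Complex.equivRealProdCLM.toHomeomorph hUopen hUsc
    (nonempty_compl.mp hUcompl.nonempty)
  obtain ⟨⟨s⟩, ⟨b⟩⟩ := PrimeEnds.nonempty_homeomorph_sphere_closedBall
  obtain ⟨⟨s'⟩, ⟨b'⟩⟩ := h.nonempty_homeomorph
  exact ⟨⟨s'.trans s⟩, ⟨b'.trans b⟩⟩

end
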